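/- Let G be a nontrivial connected graph with m edges. Then rc(G) = m − 2 if and only if one of the following holds: (i) G is isomorphic to the cycle C₅; (ii) G is a connected unicyclic graph of girth 3 with unique cycle v₁v₂v₃v₁ and there is an index i (mod 3) with l(vᵢ) = 0, l(v_{i+1}) ≤ 2 and l(v_{i+2}) ≤ 2; (iii) G is a connected unicyclic graph of girth 4 with unique cycle v₁v₂v₃v₄v₁ and there is an index i (mod 4) with l(vᵢ) = l(v_{i+2}) = 0, l(v_{i+1}) ≤ 1 and l(v_{i+3}) ≤ 1. -/

import Mathlib

/-- An edge-colored graph is rainbow connected if every two vertices are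
joined by a path no two of whose edges have the same color. -/
def IsRainbowConnected {V α : Type*} (G : SimpleGraph V) (c : Sym2 V → α) : Prop :=
  ∀ u w : V, ∃ p : G.Walk u w, p.IsPath ∧ (p.edges.map c).Nodup

/-- The rainbow connection number: the minimum number of colors in an
edge-coloring making the graph rainbow connected. -/
noncomputable def rc {V : Type*} (G : SimpleGraph V) : ℕ :=
  sInf {k : ℕ | ∃ c : Sym2 V → Fin k, IsRainbowConnected G c}


/-- The set of edges of the cycle `v 0 — v 1 — ⋯ — v (s-1) — v 0`. -/
def cycleEdges {V : Type*} {s : ℕ} (v : ZMod s → V) : Set (Sym2 V) :=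
  {e | ∃ i : ZMod s, e = s(v i, v (i + 1))}

/-- `numLeaves G v i` is `l(vᵢ)`: the number of leaves of the tree `T(vᵢ)`
attached at the cycle vertex `vᵢ`, i.e. the number of vertices, other than the
root `vᵢ`, of degree 1 in the component of `G − E(C)` containing `vᵢ`. -/
noncomputable def numLeaves {V : Type*} [Fintype V] (G : SimpleGraph V) {s : ℕ}
    (v : ZMod s → V) (i : ZMod s) : ℕ :=
  {x : V | x ≠ v i ∧ (G.deleteEdges (cycleEdges v)).Reachable (v i) x ∧
    ((G.deleteEdges (cycleEdges v)).neighborSet x).ncard = 1}.ncard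

namespace RainbowConnection

open SimpleGraph

variable {V α : Type*} {G : SimpleGraph V} {c : Sym2 V → α}

lemma isRainbowConnected_of_walks
    (h : ∀ u w, ∃ p : G.Walk u w, (p.edges.map c).Nodup) : IsRainbowConnected G c := by
  classical
  intro u w
  obtain ⟨p, hp⟩ := h u w
  exact ⟨p.bypass, p.bypass_isPath, hp.sublist (p.edges_bypass_sublist_edges.map c)⟩

lemma rc_le_of_injOn {β : Type*} {k : ℕ} (hc : IsRainbowConnected G c) (f : β → Fin k)
    (g : α → β) (hf : f.Injective) (hg : Set.InjOn g (c '' G.edgeSet)) : rc G ≤ k := by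
  refine Nat.sInf_le ⟨fun e ↦ f (g (c e)), fun u w ↦ ?_⟩
  obtain ⟨p, hp, hn⟩ := hc u w
  refine ⟨p, hp, ?_⟩
  have := (hn.map_on fun x hx y hy hxy ↦ ?_ : ((p.edges.map c).map fun a ↦ f (g a)).Nodup)
  · simpa [Function.comp_def] using this
  · simp only [List.mem_map] at hx hy
    obtain ⟨e, he, rfl⟩ := hx
    obtain ⟨e', he', rfl⟩ := hy
    exact hg ⟨e, p.edges_subset_edgeSet he, rfl⟩ ⟨e', p.edges_subset_edgeSet he', rfl⟩ (hf hxy)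

/-- A rainbow connected coloring uses at least `rc G` colors on the edges of `G`. -/
lemma rc_le_ncard_image [Finite V] (hne : G.edgeSet.Nonempty) (hc : IsRainbowConnected G c) :
    rc G ≤ (c '' G.edgeSet).ncard := by
  classical
  set S := c '' G.edgeSet with hS
  have : Finite S := (G.edgeSet.toFinite.image c).to_subtype
  obtain ⟨e₀, he₀⟩ := hne
  have φ : S ≃ Fin S.ncard := Finite.equivFinOfCardEq (Nat.card_coe_set_eq S)
  refine rc_le_of_injOn hc φ (fun a ↦ if h : a ∈ S then ⟨a, h⟩ else ⟨c e₀, e₀, he₀, rfl⟩)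
    φ.injective fun a ha b hb hab ↦ ?_
  rw [← hS] at ha hb
  simp only [dif_pos ha, dif_pos hb] at hab
  exact congrArg Subtype.val hab

lemma exists_rainbow_coloring [Finite V] (hG : G.Connected) :
    ∃ c : Sym2 V → Fin (rc G), IsRainbowConnected G c := by
  have : {k : ℕ | ∃ c : Sym2 V → Fin k, IsRainbowConnected G c}.Nonempty := by
    obtain ⟨n, ⟨φ⟩⟩ := Finite.exists_equiv_fin (Sym2 V)
    refine ⟨n, φ, fun u w ↦ ?_⟩
    obtain ⟨p, hp⟩ := hG.exists_isPath u w
    exact ⟨p, hp, hp.isTrail.edges_nodup.map φ.injective⟩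
  exact Nat.sInf_mem this

lemma rc_le_of_subset [Fintype V] (hG : G.Connected) :
    ∀ (d k : ℕ) (S : Finset V) (c : Sym2 V → ℕ), S.Nonempty → S.card + d = Fintype.card V →
      (∀ e, c e < k) →
      (∀ u ∈ S, ∀ w ∈ S, ∃ p : G.Walk u w, (∀ z ∈ p.support, z ∈ S) ∧ (p.edges.map c).Nodup) →
      rc G ≤ k + d := by
  classical
  intro d
  induction d with
  | zero =>
    intro k S c _ hcard hc h
    have hS : S = Finset.univ := Finset.eq_univ_of_card S (by simpa using hcard)
    refine Nat.sInf_le ⟨fun e ↦ ⟨c e, hc e⟩, isRainbowConnected_of_walks fun u w ↦ ?_⟩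
    obtain ⟨p, -, hp⟩ := h u (by simp [hS]) w (by simp [hS])
    refine ⟨p, ?_⟩
    have : p.edges.map c = (p.edges.map fun e ↦ (⟨c e, hc e⟩ : Fin k)).map Fin.val := by simp
    exact List.Nodup.of_map _ (this ▸ hp)
  | succ d ih =>
    intro k S c ⟨y₀, hy₀⟩ hcard hc h
    obtain ⟨x₀, hx₀⟩ : ∃ x, x ∉ S := by
      by_contra! hall
      have := Finset.eq_univ_of_forall hall
      rw [this, Finset.card_univ] at hcard
      omega
    obtain ⟨q⟩ := hG.preconnected y₀ x₀
    obtain ⟨a, -, hy, hx⟩ := q.exists_boundary_dart (S : Set V) hy₀ hx₀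
    obtain ⟨⟨y, x⟩, hyx⟩ := a
    simp only [Finset.mem_coe] at hy hx
    have hyx : G.Adj y x := hyx
    have hold : ∀ {u w} (p : G.Walk u w), (∀ z ∈ p.support, z ∈ S) →
        p.edges.map (Function.update c s(y, x) k) = p.edges.map c := by
      intro u w p hp
      refine List.map_congr_left fun e he ↦ Function.update_of_ne ?_ _ _
      rintro rfl
      exact hx (hp _ (p.snd_mem_support_of_mem_edges he))
    have hlt : ∀ (l : List (Sym2 V)), k ∉ l.map c := by
      intro l hl
      obtain ⟨e, -, he⟩ := List.mem_map.1 hl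
      exact (hc e).ne he
    have hfrom : ∀ w ∈ S, ∃ p : G.Walk x w, (∀ z ∈ p.support, z ∈ insert x S) ∧
        (p.edges.map (Function.update c s(y, x) k)).Nodup := by
      intro w hw
      obtain ⟨p, hp, hn⟩ := h y hy w hw
      refine ⟨.cons hyx.symm p, ?_, ?_⟩
      · intro z hz
        rcases List.mem_cons.1 (by simpa using hz) with rfl | hz
        · simp
        · exact Finset.mem_insert_of_mem (hp z hz)
      · rw [Walk.edges_cons, List.map_cons, hold p hp, Sym2.eq_swap, Function.update_self]
        exact List.nodup_cons.2 ⟨hlt _, hn⟩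
    rw [Nat.add_comm d 1, ← Nat.add_assoc]
    refine ih (k + 1) (insert x S) (Function.update c s(y, x) k) ⟨x, by simp⟩
      (by rw [Finset.card_insert_of_notMem hx]; omega) ?_ ?_
    · intro e
      rcases eq_or_ne e s(y, x) with rfl | he
      · simp
      · rw [Function.update_of_ne he]
        exact (hc e).trans (Nat.lt_succ_self k)
    · intro u hu w hw
      rcases Finset.mem_insert.1 hu with rfl | hu' <;> rcases Finset.mem_insert.1 hw with rfl | hw'
      · exact ⟨.nil, by simp, by simp⟩
      · exact hfrom w hw'
      · obtain ⟨p, hp, hn⟩ := hfrom u hu'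
        exact ⟨p.reverse, by simpa using hp, by simpa using hn⟩
      · obtain ⟨p, hp, hn⟩ := h u hu' w hw'
        exact ⟨p, fun z hz ↦ Finset.mem_insert_of_mem (hp z hz), by rwa [hold p hp]⟩

/-- Distinct bridges receive distinct colors in a rainbow connected coloring. -/
lemma injOn_bridges (hc : IsRainbowConnected G c) :
    Set.InjOn c {e | e ∈ G.edgeSet ∧ G.IsBridge e} := by
  rintro e ⟨he, hbe⟩ f ⟨hf, hbf⟩ hef
  by_contra hne
  suffices h : ∃ x u, (∀ p : G.Walk x u, e ∈ p.edges) ∧ (∀ p : G.Walk x u, f ∈ p.edges) by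
    obtain ⟨x, u, h₁, h₂⟩ := h
    obtain ⟨p, -, hp⟩ := hc x u
    exact hne (List.inj_on_of_nodup_map hp (h₁ p) (h₂ p) hef)
  induction e with | h a b
  induction f with | h y z
  have conv : ∀ {g h x u : V}, ¬ (G.deleteEdges {s(g, h)}).Reachable x u →
      ∀ p : G.Walk x u, s(g, h) ∈ p.edges := fun hn p ↦ by
    by_contra hp
    exact hn (reachable_deleteEdges_iff_exists_walk.2 ⟨p, hp⟩)
  rw [isBridge_iff] at hbe hbf
  have hyz : (G.deleteEdges {s(a, b)}).Reachable y z :=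
    Adj.reachable (by rw [deleteEdges_adj]; exact ⟨hf, fun h ↦ hne h.symm⟩)
  obtain ⟨x, hx⟩ : ∃ x, ¬ (G.deleteEdges {s(a, b)}).Reachable x y := by
    by_cases h : (G.deleteEdges {s(a, b)}).Reachable a y
    · exact ⟨b, fun h' ↦ hbe (h.trans h'.symm)⟩
    · exact ⟨a, h⟩
  by_cases h : (G.deleteEdges {s(y, z)}).Reachable x y
  · exact ⟨x, z, conv fun h' ↦ hx (h'.trans hyz.symm), conv fun h' ↦ hbf (h.symm.trans h')⟩
  · exact ⟨x, y, conv hx, conv h⟩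

lemma ncard_bridges_le [Finite V] (hG : G.Connected) :
    {e | e ∈ G.edgeSet ∧ G.IsBridge e}.ncard ≤ rc G := by
  obtain ⟨c, hc⟩ := exists_rainbow_coloring hG
  rw [← (injOn_bridges hc).ncard_image]
  exact (Set.ncard_le_card _).trans (by simp)

section Cycle

variable {s : ℕ} {v : ZMod s → V}

/-- The edge of the cycle `v` leaving `v i`. -/
def cycleEdge (v : ZMod s → V) (i : ZMod s) : Sym2 V := s(v i, v (i + 1))

lemma cycleEdges_eq_range (v : ZMod s → V) : cycleEdges v = Set.range (cycleEdge v) := by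
  ext e
  simp [cycleEdges, cycleEdge, eq_comm]

lemma cycleEdge_injective (hs : 3 ≤ s) (hinj : Function.Injective v) :
    Function.Injective (cycleEdge v) := by
  intro i j h
  rcases Sym2.eq_iff.1 h with ⟨h, -⟩ | ⟨h₁, h₂⟩
  · exact hinj h
  · have h₁ := hinj h₁
    have h₂ := hinj h₂
    have h2 : ((2 : ℕ) : ZMod s) = 0 := by
      push_cast
      linear_combination h₂ - h₁
    rw [ZMod.natCast_eq_zero_iff] at h2
    have := Nat.le_of_dvd two_pos h2
    omega

lemma exists_arc (hadj : ∀ i, G.Adj (v i) (v (i + 1))) (a : ZMod s) (l : ℕ) :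
    ∃ p : G.Walk (v a) (v (a + l)),
      p.edges = (List.range l).map (fun t : ℕ ↦ cycleEdge v (a + t)) ∧
      ∀ z ∈ p.support, z ∈ Set.range v := by
  induction l with
  | zero => exact ⟨Walk.nil.copy rfl (by simp), by simp, by simp⟩
  | succ l ih =>
    obtain ⟨p, hp, hsup⟩ := ih
    refine ⟨(p.concat (hadj _)).copy rfl (by push_cast; rw [add_assoc]), ?_, ?_⟩
    · simp [Walk.edges_concat, hp, List.range_succ, cycleEdge]
    · intro z hz
      simp only [Walk.support_copy, Walk.support_concat,
        List.mem_append, List.mem_singleton] at hz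
      rcases hz with hz | rfl
      · exact hsup z hz
      · simp

/-- The coloring of the edges of a cycle by `0, 1, …, h - 1, 0, 1, …`. -/
noncomputable def cycleColoring (h : ℕ) (v : ZMod s → V) : Sym2 V → ℕ :=
  Function.extend (cycleEdge v) (fun i ↦ i.val % h) 0

lemma cycleColoring_cycleEdge (hs : 3 ≤ s) (hinj : Function.Injective v) (h : ℕ) (i : ZMod s) :
    cycleColoring h v (cycleEdge v i) = i.val % h :=
  (cycleEdge_injective hs hinj).extend_apply _ _ _

lemma cycleColoring_lt {h : ℕ} (hh : 0 < h) (e : Sym2 V) : cycleColoring h v e < h := by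
  classical
  rw [cycleColoring, Function.extend_def]
  split_ifs
  · exact Nat.mod_lt _ hh
  · exact hh

lemma val_add_natCast_mod_ne [NeZero s] (a : ZMod s) {t u : ℕ} (htu : t < u) (hu : u < s / 2) :
    (a + t).val % ((s + 1) / 2) ≠ (a + u).val % ((s + 1) / 2) := by
  have hmod : ∀ x m : ℕ, x < 2 * m → x % m = x ∧ x < m ∨ x % m = x - m ∧ m ≤ x := by
    intro x m hx
    rcases lt_or_ge x m with h | h
    · exact .inl ⟨Nat.mod_eq_of_lt h, h⟩
    · exact .inr ⟨by rw [Nat.mod_eq_sub_mod h, Nat.mod_eq_of_lt (by omega)], h⟩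
  have ha := a.val_lt
  simp only [ZMod.val_add, ZMod.val_natCast, Nat.add_mod_mod]
  have h₁ := hmod (a.val + t) s (by omega)
  have h₂ := hmod (a.val + u) s (by omega)
  have h₃ := hmod ((a.val + t) % s) ((s + 1) / 2) (by omega)
  have h₄ := hmod ((a.val + u) % s) ((s + 1) / 2) (by omega)
  omega

lemma exists_short_arc [NeZero s] (hadj : ∀ i, G.Adj (v i) (v (i + 1))) (i j : ZMod s) :
    ∃ p : G.Walk (v i) (v j), (∀ z ∈ p.support, z ∈ Set.range v) ∧
      ∃ a : ZMod s, ∃ l ≤ s / 2, (a = i ∧ a + l = j ∨ a = j ∧ a + l = i) ∧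
        p.edges.Perm ((List.range l).map (fun t : ℕ ↦ cycleEdge v (a + t))) := by
  have key : ∀ a b : ZMod s, a + ((b - a).val : ZMod s) = b := fun a b ↦ by
    rw [ZMod.natCast_zmod_val]; ring
  by_cases h : (j - i).val ≤ s / 2
  · obtain ⟨p, hp, hsup⟩ := exists_arc hadj i (j - i).val
    exact ⟨p.copy rfl (by rw [key]), by simpa using hsup, i, _, h, .inl ⟨rfl, key i j⟩,
      by simp [hp]⟩
  · have h' : (i - j).val ≤ s / 2 := by
      have h0 : j - i ≠ 0 := by
        intro h0
        simp [h0] at h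
      have := ZMod.neg_val (j - i)
      rw [if_neg h0, neg_sub] at this
      omega
    obtain ⟨p, hp, hsup⟩ := exists_arc hadj j (i - j).val
    exact ⟨(p.copy rfl (by rw [key])).reverse, by simpa using hsup, j, _, h', .inr ⟨rfl, key j i⟩,
      by
        rw [Walk.edges_reverse, Walk.edges_copy, hp]
        exact List.reverse_perm _⟩

lemma nodup_cycleColoring [NeZero s] (hs : 3 ≤ s) (hinj : Function.Injective v) (a : ZMod s)
    {l : ℕ} (hl : l ≤ s / 2) :
    (((List.range l).map (fun t : ℕ ↦ cycleEdge v (a + t))).map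
      (cycleColoring ((s + 1) / 2) v)).Nodup := by
  rw [List.map_map]
  refine List.Nodup.map_on (fun t ht u hu h ↦ ?_) List.nodup_range
  simp only [Function.comp_apply, cycleColoring_cycleEdge hs hinj, List.mem_range] at h ht hu
  rcases lt_trichotomy t u with htu | htu | htu
  · exact (val_add_natCast_mod_ne a htu (by omega) h).elim
  · exact htu
  · exact (val_add_natCast_mod_ne a htu (by omega) h.symm).elim

lemma card_image_cycle [NeZero s] [DecidableEq V] (hinj : Function.Injective v) :
    (Finset.univ.image v).card = s := by
  rw [Finset.card_image_of_injective _ hinj, Finset.card_univ, ZMod.card]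

lemma le_card_of_cycle [Fintype V] [NeZero s] (hinj : Function.Injective v) :
    s ≤ Fintype.card V := by
  simpa [ZMod.card] using Fintype.card_le_of_injective v hinj

lemma rc_le_of_cycle [Fintype V] [NeZero s] (hG : G.Connected) (hs : 3 ≤ s)
    (hinj : Function.Injective v) (hadj : ∀ i, G.Adj (v i) (v (i + 1))) :
    rc G ≤ (s + 1) / 2 + (Fintype.card V - s) := by
  classical
  have hle := le_card_of_cycle hinj
  refine rc_le_of_subset hG _ _ (Finset.univ.image v) (cycleColoring ((s + 1) / 2) v)
    ⟨v 0, by simp⟩ (by rw [card_image_cycle hinj]; omega)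
    (cycleColoring_lt (by omega)) ?_
  simp only [Finset.mem_image, Finset.mem_univ, true_and]
  rintro _ ⟨i, rfl⟩ _ ⟨j, rfl⟩
  obtain ⟨p, hsup, a, l, hl, -, hp⟩ := exists_short_arc hadj i j
  exact ⟨p, hsup, (hp.map _).nodup_iff.2 (nodup_cycleColoring hs hinj a hl)⟩

lemma rc_le_of_triangle [Fintype V] {v : ZMod 3 → V} (hG : G.Connected)
    (hinj : Function.Injective v) (hadj : ∀ i, G.Adj (v i) (v (i + 1))) :
    rc G ≤ 1 + (Fintype.card V - 3) := by
  classical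
  have hle := le_card_of_cycle hinj
  refine rc_le_of_subset hG _ _ (Finset.univ.image v) (fun _ ↦ 0)
    ⟨v 0, by simp⟩ (by rw [card_image_cycle hinj]; omega) (by simp) ?_
  simp only [Finset.mem_image, Finset.mem_univ, true_and]
  rintro _ ⟨i, rfl⟩ _ ⟨j, rfl⟩
  obtain ⟨p, hsup, a, l, hl, -, hp⟩ := exists_short_arc hadj i j
  refine ⟨p, hsup, (hp.map _).nodup_iff.2 ?_⟩
  obtain rfl | rfl : l = 0 ∨ l = 1 := by omega
  all_goals simp

lemma rc_le_of_pentagon_of_adj [Fintype V] {v : ZMod 5 → V} (hG : G.Connected)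
    (hinj : Function.Injective v) (hadj : ∀ i, G.Adj (v i) (v (i + 1)))
    {x : V} (hx : x ∉ Set.range v) (hx0 : G.Adj x (v 0)) :
    rc G ≤ 3 + (Fintype.card V - 6) := by
  classical
  have hS : (insert x (Finset.univ.image v)).card = 6 := by
    rw [Finset.card_insert_of_notMem (by simpa using hx), card_image_cycle hinj]
  have hle : 6 ≤ Fintype.card V := hS ▸ Finset.card_le_univ _
  set c := Function.update (cycleColoring 3 v) s(x, v 0) 2 with hc
  have hold : ∀ {u w} (p : G.Walk u w), (∀ z ∈ p.support, z ∈ Set.range v) →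
      p.edges.map c = p.edges.map (cycleColoring 3 v) := by
    intro u w p hp
    refine List.map_congr_left fun e he ↦ Function.update_of_ne ?_ _ _
    rintro rfl
    exact hx (hp _ (p.fst_mem_support_of_mem_edges he))
  have hfrom : ∀ j, ∃ p : G.Walk x (v j),
      (∀ z ∈ p.support, z ∈ insert x (Finset.univ.image v)) ∧ (p.edges.map c).Nodup := by
    intro j
    obtain ⟨p, hsup, a, l, hl, ha, hp⟩ := exists_short_arc hadj 0 j
    refine ⟨.cons hx0 p, ?_, ?_⟩
    · intro z hz
      rcases List.mem_cons.1 (by simpa using hz) with rfl | hz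
      · simp
      · simpa using .inr (hsup z hz)
    · rw [Walk.edges_cons, List.map_cons, hold p hsup, hc, Function.update_self, List.nodup_cons,
        (hp.map _).nodup_iff, (hp.map _).mem_iff]
      refine ⟨?_, nodup_cycleColoring (by norm_num) hinj a hl⟩
      simp only [List.map_map, List.mem_map, List.mem_range, Function.comp_apply,
        cycleColoring_cycleEdge (le_refl 3 |>.trans (by norm_num)) hinj, not_exists, not_and]
      intro t ht
      obtain ⟨rfl, -⟩ | ⟨-, hal⟩ := ha
      · obtain rfl | rfl : t = 0 ∨ t = 1 := by omega
        all_goals decide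
      · obtain rfl : a = -l := eq_neg_of_add_eq_zero_left hal
        obtain ⟨rfl, rfl⟩ | ⟨rfl, rfl⟩ | ⟨rfl, rfl⟩ :
            l = 1 ∧ t = 0 ∨ l = 2 ∧ t = 0 ∨ l = 2 ∧ t = 1 := by omega
        all_goals decide
  refine rc_le_of_subset hG _ _ (insert x (Finset.univ.image v)) c
    ⟨x, by simp⟩ (by rw [hS]; omega) ?_ ?_
  · intro e
    rcases eq_or_ne e s(x, v 0) with rfl | he
    · simp [hc]
    · rw [hc, Function.update_of_ne he]
      exact cycleColoring_lt (by norm_num) e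
  · intro u hu w hw
    rcases Finset.mem_insert.1 hu with rfl | hu' <;> rcases Finset.mem_insert.1 hw with rfl | hw'
    · exact ⟨.nil, by simp, by simp⟩
    · obtain ⟨j, -, rfl⟩ := Finset.mem_image.1 hw'
      exact hfrom j
    · obtain ⟨j, -, rfl⟩ := Finset.mem_image.1 hu'
      obtain ⟨p, hp, hn⟩ := hfrom j
      exact ⟨p.reverse, by simpa using hp, by simpa using hn⟩
    · obtain ⟨i, -, rfl⟩ := Finset.mem_image.1 hu'
      obtain ⟨j, -, rfl⟩ := Finset.mem_image.1 hw'
      obtain ⟨p, hsup, a, l, hl, -, hp⟩ := exists_short_arc hadj i j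
      refine ⟨p, fun z hz ↦ by simpa using .inr (hsup z hz), ?_⟩
      rw [hold p hsup]
      exact (hp.map _).nodup_iff.2 (nodup_cycleColoring (by norm_num) hinj a hl)

lemma rc_le_of_pentagon [Fintype V] {v : ZMod 5 → V} (hG : G.Connected)
    (hinj : Function.Injective v) (hadj : ∀ i, G.Adj (v i) (v (i + 1)))
    (hv : ¬ Function.Surjective v) : rc G ≤ 3 + (Fintype.card V - 6) := by
  obtain ⟨x₀, hx₀⟩ := not_forall.1 hv
  obtain ⟨q⟩ := hG.preconnected (v 0) x₀
  obtain ⟨⟨⟨y, x⟩, hyx⟩, -, ⟨i, rfl⟩, hx⟩ := q.exists_boundary_dart (Set.range v) ⟨0, rfl⟩ hx₀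
  refine rc_le_of_pentagon_of_adj (v := fun j ↦ v (j + i)) hG (hinj.comp (add_left_injective i))
    (fun j ↦ by simpa [add_right_comm] using hadj (j + i)) (x := x) ?_ (by simpa using hyx.symm)
  rintro ⟨j, rfl⟩
  exact hx ⟨_, rfl⟩

end Cycle

section Unicyclic

variable {s : ℕ} {v : ZMod s → V}

lemma cycleEdges_subset (hadj : ∀ i, G.Adj (v i) (v (i + 1))) : cycleEdges v ⊆ G.edgeSet := by
  rintro _ ⟨i, rfl⟩
  exact hadj i

lemma ncard_cycleEdges [NeZero s] (hs : 3 ≤ s) (hinj : Function.Injective v) :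
    (cycleEdges v).ncard = s := by
  rw [cycleEdges_eq_range, ← Set.image_univ, (cycleEdge_injective hs hinj).injOn.ncard_image,
    Set.ncard_univ, Nat.card_zmod]

lemma ncard_forest [Finite V] [NeZero s] (hs : 3 ≤ s) (hinj : Function.Injective v)
    (hadj : ∀ i, G.Adj (v i) (v (i + 1))) :
    (G.deleteEdges (cycleEdges v)).edgeSet.ncard = G.edgeSet.ncard - s := by
  rw [edgeSet_deleteEdges, Set.ncard_sdiff (cycleEdges_subset hadj), ncard_cycleEdges hs hinj]

/-- Every vertex lies in a tree attached to some vertex of the cycle. -/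
lemma exists_root [NeZero s] (hG : G.Connected) (x : V) :
    ∃ i, (G.deleteEdges (cycleEdges v)).Reachable (v i) x := by
  obtain ⟨p⟩ := hG.preconnected x (v 0)
  generalize hz : v 0 = z at p
  induction p with
  | nil => exact ⟨0, hz ▸ Reachable.refl _⟩
  | @cons x y _ h p ih =>
    by_cases he : s(x, y) ∈ cycleEdges v
    · obtain ⟨i, hi⟩ := he
      rcases Sym2.eq_iff.1 hi with ⟨rfl, -⟩ | ⟨rfl, -⟩ <;> exact ⟨_, Reachable.refl _⟩
    · obtain ⟨i, hi⟩ := ih hz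
      exact ⟨i, hi.trans (Adj.reachable (deleteEdges_adj.2 ⟨h, he⟩)).symm⟩

/-- Consecutive edges around the cycle stay available after deleting two adjacent ones. -/
lemma reachable_of_cycle [NeZero s] (hs : 3 ≤ s) (hinj : Function.Injective v)
    (hadj : ∀ i, G.Adj (v i) (v (i + 1))) (i j : ZMod s) (hij : i ≠ j) :
    ((G.deleteEdges {cycleEdge v (i - 1)}).deleteEdges {cycleEdge v i}).Reachable
      (v (i + 1)) (v j) := by
  set l := (j - (i + 1)).val with hl
  have hlt : l < s := (j - (i + 1)).val_lt
  have hj : i + 1 + (l : ZMod s) = j := by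
    rw [hl, ZMod.natCast_zmod_val]
    ring
  have hl' : l ≠ s - 1 := by
    intro h
    apply hij
    rw [← hj, h, Nat.cast_sub (by omega)]
    simp
  obtain ⟨p, hp, -⟩ := exists_arc hadj (i + 1) l
  rw [← hj]
  have hne : ∀ (n : ℕ), 0 < n → n < s → (n : ZMod s) ≠ 0 := fun n h0 hn h ↦ by
    rw [ZMod.natCast_eq_zero_iff] at h
    exact absurd (Nat.le_of_dvd h0 h) (by omega)
  refine ⟨p.transfer _ fun e he ↦ ?_⟩
  rw [edgeSet_deleteEdges, edgeSet_deleteEdges]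
  have heG := p.edges_subset_edgeSet he
  rw [hp] at he
  obtain ⟨t, ht, rfl⟩ := List.mem_map.1 he
  rw [List.mem_range] at ht
  refine ⟨⟨heG, fun h ↦ ?_⟩, fun h ↦ ?_⟩
  · have h := cycleEdge_injective hs hinj h
    refine hne (t + 2) (by omega) (by omega) ?_
    push_cast
    linear_combination h
  · have h := cycleEdge_injective hs hinj h
    refine hne (t + 1) (by omega) (by omega) ?_
    push_cast
    linear_combination h

lemma isTree_deleteEdge [Fintype V] [NeZero s] (hG : G.Connected)
    (hm : G.edgeSet.ncard = Fintype.card V) (hs : 3 ≤ s) (hinj : Function.Injective v)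
    (hadj : ∀ i, G.Adj (v i) (v (i + 1))) (i : ZMod s) :
    (G.deleteEdges {cycleEdge v i}).IsTree := by
  have hone : (1 : ZMod s) ≠ 0 := by
    have : Fact (1 < s) := ⟨by omega⟩
    exact one_ne_zero
  refine isTree_iff_connected_and_card.2
    ⟨hG.connected_delete_edge_of_not_isBridge fun h ↦ ?_, ?_⟩
  · rw [isBridge_iff] at h
    have := (reachable_of_cycle hs hinj hadj (i + 1) i (by simpa using hone)).mono
      (deleteEdges_le _)
    rw [add_sub_cancel_right] at this
    have h2 : (G.deleteEdges {cycleEdge v i}).Adj (v (i + 1)) (v (i + 1 + 1)) := by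
      refine deleteEdges_adj.2 ⟨hadj _, fun h ↦ hone ?_⟩
      simpa using cycleEdge_injective hs hinj (a₁ := i + 1) (a₂ := i) h
    exact h (h2.reachable.trans this).symm
  · rw [Nat.card_coe_set_eq, edgeSet_deleteEdges, Set.ncard_sdiff_singleton_of_mem
      (show cycleEdge v i ∈ G.edgeSet from hadj i), hm, Nat.card_eq_fintype_card]
    have := le_card_of_cycle hinj
    omega

lemma isAcyclic_forest [Fintype V] [NeZero s] (hG : G.Connected)
    (hm : G.edgeSet.ncard = Fintype.card V) (hs : 3 ≤ s) (hinj : Function.Injective v)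
    (hadj : ∀ i, G.Adj (v i) (v (i + 1))) : (G.deleteEdges (cycleEdges v)).IsAcyclic := by
  refine (isTree_deleteEdge hG hm hs hinj hadj 0).isAcyclic.anti (deleteEdges_anti ?_)
  rintro _ rfl
  exact ⟨0, rfl⟩

lemma root_unique [Fintype V] [NeZero s] (hG : G.Connected)
    (hm : G.edgeSet.ncard = Fintype.card V) (hs : 3 ≤ s) (hinj : Function.Injective v)
    (hadj : ∀ i, G.Adj (v i) (v (i + 1))) {i j : ZMod s}
    (h : (G.deleteEdges (cycleEdges v)).Reachable (v i) (v j)) : i = j := by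
  by_contra hij
  have hone : (1 : ZMod s) ≠ 0 := by
    have : Fact (1 < s) := ⟨by omega⟩
    exact one_ne_zero
  have hb : (G.deleteEdges {cycleEdge v (i - 1)}).IsBridge (cycleEdge v i) := by
    refine isAcyclic_iff_forall_isBridge.1
      (isTree_deleteEdge hG hm hs hinj hadj (i - 1)).isAcyclic ?_
    rw [edgeSet_deleteEdges]
    refine ⟨hadj i, fun h ↦ hone ?_⟩
    linear_combination cycleEdge_injective hs hinj h
  refine isBridge_iff.1 hb ((h.mono ?_).trans (reachable_of_cycle hs hinj hadj i j hij).symm)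
  rw [deleteEdges_deleteEdges]
  refine deleteEdges_anti ?_
  rintro _ (rfl | rfl) <;> exact ⟨_, rfl⟩

/-- The data of a graph with a cycle outside which it is a forest rooted at the cycle. -/
structure IsForestOnCycle (G : SimpleGraph V) (v : ZMod s → V) : Prop where
  acyclic : (G.deleteEdges (cycleEdges v)).IsAcyclic
  exists_root : ∀ x, ∃ i, (G.deleteEdges (cycleEdges v)).Reachable (v i) x
  root_unique : ∀ {i j}, (G.deleteEdges (cycleEdges v)).Reachable (v i) (v j) → i = j

lemma isForestOnCycle [Fintype V] [NeZero s] (hG : G.Connected)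
    (hm : G.edgeSet.ncard = Fintype.card V) (hs : 3 ≤ s) (hinj : Function.Injective v)
    (hadj : ∀ i, G.Adj (v i) (v (i + 1))) : IsForestOnCycle G v :=
  ⟨isAcyclic_forest hG hm hs hinj hadj, exists_root hG, root_unique hG hm hs hinj hadj⟩

/-- `x` is a leaf of the tree attached at `v i`. -/
def IsLeafAt (G : SimpleGraph V) (v : ZMod s → V) (i : ZMod s) (x : V) : Prop :=
  x ≠ v i ∧ (G.deleteEdges (cycleEdges v)).Reachable (v i) x ∧
    ((G.deleteEdges (cycleEdges v)).neighborSet x).ncard = 1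

lemma numLeaves_eq_ncard [Fintype V] (i : ZMod s) :
    numLeaves G v i = {x | IsLeafAt G v i x}.ncard := rfl

lemma numLeaves_congr [Fintype V] {w : ZMod s → V} (h : cycleEdges v = cycleEdges w)
    {i j : ZMod s} (hij : v i = w j) : numLeaves G v i = numLeaves G w j := by
  rw [numLeaves, numLeaves, h, hij]

lemma cycleEdges_shift (k : ZMod s) : cycleEdges (fun j ↦ v (j + k)) = cycleEdges v := by
  ext e
  constructor
  · rintro ⟨i, rfl⟩
    exact ⟨i + k, by simp [add_right_comm]⟩
  · rintro ⟨i, rfl⟩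
    exact ⟨i - k, by simp [sub_add_eq_add_sub]⟩

lemma numLeaves_shift [Fintype V] (k i : ZMod s) :
    numLeaves G (fun j ↦ v (j + k)) i = numLeaves G v (i + k) :=
  numLeaves_congr (cycleEdges_shift k) rfl

namespace IsForestOnCycle

/-- If no cycle vertex is on the side of `x` of the forest edge `f`, then walks leaving this side
pass through `f`. -/
lemma mem_edges_of_cut {f : Sym2 V} {x u : V}
    (hx : ∀ j, ¬ ((G.deleteEdges (cycleEdges v)).deleteEdges {f}).Reachable x (v j))
    (hu : ¬ ((G.deleteEdges (cycleEdges v)).deleteEdges {f}).Reachable x u) (w : G.Walk x u) :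
    f ∈ w.edges := by
  obtain ⟨d, hd, h₁, h₂⟩ := w.exists_boundary_dart
    {z | ((G.deleteEdges (cycleEdges v)).deleteEdges {f}).Reachable x z} (Reachable.refl _) hu
  by_cases hc : s(d.fst, d.snd) ∈ cycleEdges v
  · obtain ⟨i, hi⟩ := hc
    rcases Sym2.eq_iff.1 hi with ⟨h, -⟩ | ⟨h, -⟩
    · exact (hx i (h ▸ h₁)).elim
    · exact (hx (i + 1) (h ▸ h₁)).elim
  · have hf : s(d.fst, d.snd) = f := by
      by_contra hne
      exact h₂ (Reachable.trans h₁
        (Adj.reachable (deleteEdges_adj.2 ⟨deleteEdges_adj.2 ⟨d.adj, hc⟩, hne⟩)))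
    rw [← hf]
    exact List.mem_map.2 ⟨d, hd, rfl⟩

variable (hF : IsForestOnCycle G v)
include hF

lemma eq_of_reachable {i j : ZMod s} {x : V}
    (hi : (G.deleteEdges (cycleEdges v)).Reachable (v i) x)
    (hj : (G.deleteEdges (cycleEdges v)).Reachable (v j) x) : i = j :=
  hF.root_unique (hi.trans hj.symm)

/-- Walks from a vertex to the root of its tree, or to another tree, use all the edges
of the forest path to the root. -/
lemma mem_edges_of_path {f : Sym2 V} {i : ZMod s} {x u : V}
    {p : (G.deleteEdges (cycleEdges v)).Walk (v i) x} (hp : p.IsPath) (hf : f ∈ p.edges)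
    (hu : u = v i ∨ ∃ j, j ≠ i ∧ (G.deleteEdges (cycleEdges v)).Reachable (v j) u)
    (w : G.Walk x u) : f ∈ w.edges := by
  classical
  induction f with | h a b
  have hxi : ¬ ((G.deleteEdges (cycleEdges v)).deleteEdges {s(a, b)}).Reachable x (v i) := by
    intro h
    obtain ⟨q, hq⟩ := reachable_deleteEdges_iff_exists_walk.1 h.symm
    have hqp : q.bypass = p :=
      congrArg Subtype.val ((hF.acyclic.subsingleton_path _ _).elim ⟨_, q.bypass_isPath⟩ ⟨p, hp⟩)
    exact hq (q.edges_bypass_subset_edges (hqp ▸ hf))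
  have hxj : ∀ j, j ≠ i → ∀ u, (G.deleteEdges (cycleEdges v)).Reachable (v j) u →
      ¬ ((G.deleteEdges (cycleEdges v)).deleteEdges {s(a, b)}).Reachable x u := by
    intro j hj u hju h
    exact hj (hF.root_unique ((hju.trans (h.mono (deleteEdges_le _)).symm).trans
      p.reachable.symm))
  refine mem_edges_of_cut (v := v) (fun j ↦ ?_) ?_ w
  · rcases eq_or_ne j i with rfl | hj
    · exact hxi
    · exact hxj j hj _ (Reachable.refl _)
  · rcases hu with rfl | ⟨j, hj, hju⟩
    · exact hxi
    · exact hxj j hj _ hju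

lemma isBridge {f : Sym2 V} (hf : f ∈ (G.deleteEdges (cycleEdges v)).edgeSet) : G.IsBridge f := by
  have hb := isAcyclic_iff_forall_isBridge.1 hF.acyclic hf
  induction f with | h a b
  rw [isBridge_iff] at hb
  rw [isBridge_iff_forall_walk_mem_edges]
  intro w
  by_cases ha : ∃ i, ((G.deleteEdges (cycleEdges v)).deleteEdges {s(a, b)}).Reachable a (v i)
  · obtain ⟨i, hi⟩ := ha
    have hb' : s(a, b) ∈ w.reverse.edges := by
      refine mem_edges_of_cut (v := v) (fun j hj ↦ ?_) (fun h ↦ hb h.symm) w.reverse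
      have hle := deleteEdges_le (G := G.deleteEdges (cycleEdges v)) {s(a, b)}
      obtain rfl := hF.root_unique (((hi.mono hle).symm.trans (Adj.reachable hf)).trans
        (hj.mono hle))
      exact hb (hi.trans hj.symm)
    simpa using hb'
  · exact mem_edges_of_cut (v := v) (not_exists.1 ha) hb w

/-- Every forest edge lies on the path from a root to a leaf. -/
lemma exists_leaf_of_mem_edges [Fintype V] {f : Sym2 V} {i : ZMod s} :
    ∀ (d : ℕ) {x : V} (p : (G.deleteEdges (cycleEdges v)).Walk (v i) x), p.IsPath →
      f ∈ p.edges → Fintype.card V ≤ p.length + d →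
      ∃ y, IsLeafAt G v i y ∧ ∃ q : (G.deleteEdges (cycleEdges v)).Walk (v i) y,
        q.IsPath ∧ f ∈ q.edges := by
  intro d
  induction d with
  | zero =>
    intro x p hp hf hd
    exact absurd hp.length_lt (by omega)
  | succ d ih =>
    intro x p hp hf hd
    have hnil : ¬ p.Nil := by
      intro h
      simp [Walk.edges_eq_nil.2 h] at hf
    by_cases hex : ∃ y, (G.deleteEdges (cycleEdges v)).Adj x y ∧ y ≠ p.penultimate
    · obtain ⟨y, hxy, hy⟩ := hex
      have hys : y ∉ p.support := fun h ↦ hy (hF.acyclic.eq_penultimate_of_adj_end hp hxy h)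
      exact ih (p.concat hxy) (hp.concat hys hxy) (by simp [Walk.edges_concat, hf])
        (by rw [Walk.length_concat]; omega)
    · push Not at hex
      refine ⟨x, ⟨?_, p.reachable, ?_⟩, p, hp, hf⟩
      · rintro rfl
        exact hnil (Walk.isPath_iff_nil.1 hp)
      · rw [Set.ncard_eq_one]
        refine ⟨p.penultimate, Set.eq_singleton_iff_unique_mem.2
          ⟨(p.adj_penultimate hnil).symm, fun y hy ↦ hex y hy⟩⟩

lemma exists_leaf [Fintype V] {f : Sym2 V}
    (hf : f ∈ (G.deleteEdges (cycleEdges v)).edgeSet) :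
    ∃ i x, IsLeafAt G v i x ∧ ∃ p : (G.deleteEdges (cycleEdges v)).Walk (v i) x,
      p.IsPath ∧ f ∈ p.edges := by
  classical
  induction f with | h a b
  have hab : (G.deleteEdges (cycleEdges v)).Adj a b := hf
  obtain ⟨i, hi⟩ := hF.exists_root a
  obtain ⟨p, hp⟩ := hi.exists_isPath
  obtain ⟨q, hq⟩ := (hi.trans hab.reachable).exists_isPath
  refine ⟨i, ?_⟩
  by_cases hb : b ∈ p.support
  · have ha := hF.acyclic.ne_mem_support_of_support_of_adj_of_isPath hp hq hab hb
    exact hF.exists_leaf_of_mem_edges _ (q.concat hab.symm) (hq.concat ha hab.symm)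
      (by simp [Walk.edges_concat, Sym2.eq_swap]) (Nat.le_add_left _ _)
  · exact hF.exists_leaf_of_mem_edges _ (p.concat hab) (hp.concat hb hab)
      (by simp [Walk.edges_concat]) (Nat.le_add_left _ _)

/-- The edge at a leaf is only used by forest paths from a root to that leaf. -/
lemma exists_leaf_edge {k : ZMod s} {x : V} (hx : IsLeafAt G v k x) :
    ∃ f ∈ (G.deleteEdges (cycleEdges v)).edgeSet,
      (∀ i w (p : (G.deleteEdges (cycleEdges v)).Walk (v i) w), p.IsPath → f ∈ p.edges →
        i = k ∧ w = x) ∧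
      ∃ p : (G.deleteEdges (cycleEdges v)).Walk (v k) x, p.IsPath ∧ f ∈ p.edges := by
  obtain ⟨hxk, hreach, hcard⟩ := hx
  obtain ⟨p, hp⟩ := hreach.exists_isPath
  obtain ⟨y, hy⟩ := Set.ncard_eq_one.1 hcard
  have hnil : ¬ p.Nil := fun h ↦ hxk h.eq.symm
  have hpen := (p.adj_penultimate hnil).symm
  have hyp : p.penultimate = y := by
    have : p.penultimate ∈ (G.deleteEdges (cycleEdges v)).neighborSet x := hpen
    rw [hy] at this
    exact this
  refine ⟨s(p.penultimate, x), hpen.symm, ?_, p, hp, p.mk_penultimate_end_mem_edges hnil⟩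
  intro i w q hq hf
  have hxq : x ∈ q.support := q.snd_mem_support_of_mem_edges hf
  obtain rfl : i = k := by
    classical
    exact hF.eq_of_reachable (q.takeUntil x hxq).reachable hreach
  refine ⟨rfl, ?_⟩
  obtain ⟨q₁, q₂, hq₁, hq₂, rfl⟩ := hq.mem_support_iff_exists_append.1 hxq
  cases q₂ with
  | nil => rfl
  | @cons _ z _ h q₂ =>
    exfalso
    have hz : z = y := by
      have : z ∈ (G.deleteEdges (cycleEdges v)).neighborSet x := h
      rw [hy] at this
      exact this
    have hpq : q₁ = p :=
      congrArg Subtype.val ((hF.acyclic.subsingleton_path _ _).elim ⟨_, hq₁⟩ ⟨p, hp⟩)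
    subst hpq
    refine hq.ne_of_mem_support_of_append (x := z) (y := z) h.ne' ?_ ?_ rfl
    · rw [hz, ← hyp]
      exact q₁.getVert_mem_support _
    · simp

/-- A walk leaving the tree at `v i` uses an edge of the cycle incident to `v i`. -/
lemma exists_cycle_edge {i j : ZMod s} {x u : V} (hij : i ≠ j)
    (hx : (G.deleteEdges (cycleEdges v)).Reachable (v i) x)
    (hu : (G.deleteEdges (cycleEdges v)).Reachable (v j) u) (w : G.Walk x u) :
    ∃ l, (l = i + 1 ∨ i = l + 1) ∧ s(v i, v l) ∈ w.edges := by
  obtain ⟨d, hd, h₁, h₂⟩ := w.exists_boundary_dart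
    {z | (G.deleteEdges (cycleEdges v)).Reachable (v i) z} hx
    (fun h ↦ hij (hF.eq_of_reachable h hu))
  have hde : s(d.fst, d.snd) ∈ w.edges := List.mem_map.2 ⟨d, hd, rfl⟩
  by_cases hc : s(d.fst, d.snd) ∈ cycleEdges v
  · obtain ⟨l, hl⟩ := hc
    rcases Sym2.eq_iff.1 hl with ⟨h, -⟩ | ⟨h, -⟩
    · obtain rfl := hF.root_unique (h ▸ h₁ : (G.deleteEdges (cycleEdges v)).Reachable (v i) (v l))
      exact ⟨_, .inl rfl, hl ▸ hde⟩
    · obtain rfl := hF.root_unique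
        (h ▸ h₁ : (G.deleteEdges (cycleEdges v)).Reachable (v i) (v (l + 1)))
      exact ⟨l, .inr rfl, by rw [Sym2.eq_swap]; exact hl ▸ hde⟩
  · exact (h₂ (Reachable.trans h₁ (Adj.reachable (deleteEdges_adj.2 ⟨d.adj, hc⟩)))).elim

/-- Forest edges keep their own name as color; the `i`-th cycle edge gets color `g i`. -/
lemma rc_le_of_arcs [Finite V] [NeZero s] (hs : 3 ≤ s) (hinj : Function.Injective v)
    (hadj : ∀ i, G.Adj (v i) (v (i + 1))) (g : ZMod s → Sym2 V) (T : Set (Sym2 V))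
    (hFT : (G.deleteEdges (cycleEdges v)).edgeSet ⊆ T) (hgT : ∀ i, g i ∈ T)
    (H : ∀ i j, i ≠ j → ∀ x u (p : (G.deleteEdges (cycleEdges v)).Walk (v i) x)
      (q : (G.deleteEdges (cycleEdges v)).Walk (v j) u), p.IsPath → q.IsPath →
      ∃ (a : G.Walk (v i) (v j)) (L : List (ZMod s)), a.edges.Perm (L.map (cycleEdge v)) ∧
        (L.map g).Nodup ∧ ∀ k ∈ L, g k ∉ p.edges ∧ g k ∉ q.edges) :
    rc G ≤ T.ncard := by
  classical
  have hcinj := cycleEdge_injective hs hinj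
  set c : Sym2 V → Sym2 V := Function.extend (cycleEdge v) g id with hc
  have hcC : ∀ i, c (cycleEdge v i) = g i := fun i ↦ hcinj.extend_apply _ _ _
  have hcF : ∀ e ∉ cycleEdges v, c e = e := by
    intro e he
    rw [hc, Function.extend_apply']
    · rfl
    · rwa [cycleEdges_eq_range] at he
  have hcP : ∀ {x y} (p : (G.deleteEdges (cycleEdges v)).Walk x y), p.edges.map c = p.edges := by
    intro x y p
    conv_rhs => rw [← List.map_id p.edges]
    refine List.map_congr_left fun e he ↦ hcF e ?_
    have := p.edges_subset_edgeSet he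
    rw [edgeSet_deleteEdges] at this
    exact this.2
  have hle : G.deleteEdges (cycleEdges v) ≤ G := deleteEdges_le _
  have hlift : ∀ {x y} (p : (G.deleteEdges (cycleEdges v)).Walk x y),
      (p.mapLe hle).edges = p.edges := fun p ↦ by simp
  refine (rc_le_ncard_image ⟨cycleEdge v 0, hadj 0⟩ (c := c)
    (isRainbowConnected_of_walks fun x u ↦ ?_)).trans (Set.ncard_le_ncard ?_ T.toFinite)
  · obtain ⟨i, hi⟩ := hF.exists_root x
    obtain ⟨j, hj⟩ := hF.exists_root u
    rcases eq_or_ne i j with rfl | hij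
    · obtain ⟨p, hp⟩ := (hi.symm.trans hj).exists_isPath
      exact ⟨p.mapLe hle, by rw [hlift, hcP]; exact hp.isTrail.edges_nodup⟩
    · obtain ⟨p, hp⟩ := hi.exists_isPath
      obtain ⟨q, hq⟩ := hj.exists_isPath
      obtain ⟨a, L, ha, hL, hk⟩ := H i j hij x u p q hp hq
      have hac : (a.edges.map c).Perm (L.map g) := by
        refine (ha.map c).trans (List.Perm.of_eq ?_)
        rw [List.map_map]
        exact List.map_congr_left fun k _ ↦ hcC k
      refine ⟨((p.mapLe hle).reverse.append a).append (q.mapLe hle), ?_⟩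
      rw [Walk.edges_append, Walk.edges_append, Walk.edges_reverse, List.map_append,
        List.map_append, List.map_reverse, hlift, hlift, hcP, hcP]
      refine List.Nodup.append (List.Nodup.append (List.nodup_reverse.2 hp.isTrail.edges_nodup)
        (hac.nodup_iff.2 hL) ?_) hq.isTrail.edges_nodup ?_
      · intro e he he'
        obtain ⟨k, hkL, rfl⟩ := List.mem_map.1 (hac.mem_iff.1 he')
        exact (hk k hkL).1 (List.mem_reverse.1 he)
      · intro e he he'
        rcases List.mem_append.1 he with he | he
        · induction e with | h y z
          have h₁ := p.fst_mem_support_of_mem_edges (List.mem_reverse.1 he)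
          have h₂ := q.fst_mem_support_of_mem_edges he'
          exact hij (hF.eq_of_reachable (p.takeUntil y h₁).reachable
            (q.takeUntil y h₂).reachable)
        · obtain ⟨k, hkL, rfl⟩ := List.mem_map.1 (hac.mem_iff.1 he)
          exact (hk k hkL).2 he'
  · rintro _ ⟨e, he, rfl⟩
    by_cases hec : e ∈ cycleEdges v
    · rw [cycleEdges_eq_range] at hec
      obtain ⟨i, rfl⟩ := hec
      rw [hcC]
      exact hgT i
    · rw [hcF e hec]
      exact hFT (by rw [edgeSet_deleteEdges]; exact ⟨he, hec⟩)

end IsForestOnCycle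

end Unicyclic

section UpperBounds

lemma zmod_four_cases : ∀ i : ZMod 4, i = 0 ∨ i = 1 ∨ i = 2 ∨ i = 3 := by
  decide

/-- The indices of the first `l` cycle edges met when walking from `v i`. -/
def arc {s : ℕ} (i : ZMod s) (l : ℕ) : List (ZMod s) := (List.range l).map fun t : ℕ ↦ i + t

/-- The edges of the cycle listed in `L` have distinct colors, none of which occurs in the lists
`A` and `B`. -/
def IsFreeArc {s : ℕ} (g : ZMod s → Sym2 V) (A B : List (Sym2 V)) (L : List (ZMod s)) : Prop :=
  (L.map g).Nodup ∧ ∀ k ∈ L, g k ∉ A ∧ g k ∉ B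

lemma isFreeArc_one {s : ℕ} {g : ZMod s → Sym2 V} {A B : List (Sym2 V)} {i : ZMod s} :
    IsFreeArc g A B (arc i 1) ↔ g i ∉ A ∧ g i ∉ B := by
  simp [IsFreeArc, arc]

lemma isFreeArc_two {s : ℕ} {g : ZMod s → Sym2 V} {A B : List (Sym2 V)} {i : ZMod s} :
    IsFreeArc g A B (arc i 2) ↔ g i ≠ g (i + 1) ∧ (g i ∉ A ∧ g i ∉ B) ∧
      g (i + 1) ∉ A ∧ g (i + 1) ∉ B := by
  simp [IsFreeArc, arc, List.range_succ]

lemma IsForestOnCycle.rc_le_of_isFreeArc [Finite V] {s : ℕ} [NeZero s] {v : ZMod s → V}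
    (hF : IsForestOnCycle G v) (hs : 3 ≤ s) (hinj : Function.Injective v)
    (hadj : ∀ i, G.Adj (v i) (v (i + 1))) (g : ZMod s → Sym2 V) (T : Set (Sym2 V))
    (hFT : (G.deleteEdges (cycleEdges v)).edgeSet ⊆ T) (hgT : ∀ i, g i ∈ T)
    (H : ∀ (i : ZMod s) (l : ℕ), 0 < l → 2 * l ≤ s →
      ∀ x u (p : (G.deleteEdges (cycleEdges v)).Walk (v i) x)
        (q : (G.deleteEdges (cycleEdges v)).Walk (v (i + l)) u), p.IsPath → q.IsPath →
        IsFreeArc g p.edges q.edges (arc i l) ∨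
          IsFreeArc g p.edges q.edges (arc (i + l) (s - l))) :
    rc G ≤ T.ncard := by
  refine hF.rc_le_of_arcs hs hinj hadj g T hFT hgT ?_
  have key : ∀ (i j : ZMod s), i ≠ j → 2 * (j - i).val ≤ s → ∀ x u
      (p : (G.deleteEdges (cycleEdges v)).Walk (v i) x)
      (q : (G.deleteEdges (cycleEdges v)).Walk (v j) u), p.IsPath → q.IsPath →
      ∃ (a : G.Walk (v i) (v j)) (L : List (ZMod s)), a.edges.Perm (L.map (cycleEdge v)) ∧
        IsFreeArc g p.edges q.edges L := by
    intro i j hij hl x u p q hp hq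
    obtain ⟨l, hl'⟩ : ∃ l, l = (j - i).val := ⟨_, rfl⟩
    have hls : l < s := hl' ▸ (j - i).val_lt
    have hl0 : 0 < l := by
      rw [hl', Nat.pos_iff_ne_zero, Ne, ZMod.val_eq_zero, sub_eq_zero]
      exact hij.symm
    rw [← hl'] at hl
    obtain rfl : j = i + l := by
      rw [hl', ZMod.natCast_zmod_val]
      ring
    rcases H i l hl0 hl x u p q hp hq with h | h
    · obtain ⟨a, ha, -⟩ := exists_arc hadj i l
      exact ⟨a, _, .of_eq (by rw [ha, arc, List.map_map]; rfl), h⟩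
    · obtain ⟨a, ha, -⟩ := exists_arc hadj (i + l) (s - l)
      have hend : i + l + ((s - l : ℕ) : ZMod s) = i := by
        rw [Nat.cast_sub hls.le]
        simp
      refine ⟨(a.copy rfl (congrArg v hend)).reverse, _, ?_, h⟩
      rw [Walk.edges_reverse, Walk.edges_copy, ha, arc, List.map_map]
      exact List.reverse_perm _
  intro i j hij x u p q hp hq
  rcases le_total (2 * (j - i).val) s with h | h
  · exact key i j hij h x u p q hp hq
  · obtain ⟨a, L, ha, hL, hk⟩ := key j i hij.symm (by
      have : NeZero (j - i) := ⟨sub_ne_zero.2 hij.symm⟩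
      rw [← neg_sub, ZMod.val_neg_of_ne_zero]
      omega) u x q p hq hp
    exact ⟨a.reverse, L, by rw [Walk.edges_reverse]; exact (List.reverse_perm _).trans ha, hL,
      fun k h ↦ (hk k h).symm⟩

variable [Fintype V]

/-- If every tree at a triangle is nontrivial, then each cycle edge may reuse the color
of a leaf edge of the opposite tree. -/
lemma IsForestOnCycle.rc_le_of_triangle_of_leaf {v : ZMod 3 → V} (hF : IsForestOnCycle G v)
    (hinj : Function.Injective v) (hadj : ∀ i, G.Adj (v i) (v (i + 1)))
    (hl : ∀ i, ∃ x, IsLeafAt G v i x) : rc G ≤ (G.deleteEdges (cycleEdges v)).edgeSet.ncard := by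
  choose x hx using hl
  choose f hfF hf _ using fun i ↦ hF.exists_leaf_edge (hx i)
  refine hF.rc_le_of_isFreeArc le_rfl hinj hadj (fun i ↦ f (i + 2)) _ subset_rfl
    (fun i ↦ hfF _) fun i l h₀ h₁ y u p q hp hq ↦ ?_
  obtain rfl : l = 1 := by omega
  refine .inl ⟨by simp [arc], ?_⟩
  simp only [arc, List.range_one, List.map_cons, List.map_nil, List.mem_singleton,
    Nat.cast_zero, add_zero, forall_eq]
  refine ⟨fun h ↦ ?_, fun h ↦ ?_⟩
  · exact (by decide : ∀ i : ZMod 3, i ≠ i + 2) i (hf _ _ _ _ hp h).1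
  · exact (by decide : ∀ i : ZMod 3, i + (1 : ℕ) ≠ i + 2) i (hf _ _ _ _ hq h).1

/-- If a tree at a triangle has three leaves, then the cycle edges may reuse the colors of their
edges. -/
lemma IsForestOnCycle.rc_le_of_triangle_of_three_leaves {v : ZMod 3 → V}
    (hF : IsForestOnCycle G v) (hinj : Function.Injective v)
    (hadj : ∀ i, G.Adj (v i) (v (i + 1))) {x : ZMod 3 → V} (hxinj : Function.Injective x)
    (hx : ∀ i, IsLeafAt G v 0 (x i)) :
    rc G ≤ (G.deleteEdges (cycleEdges v)).edgeSet.ncard := by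
  choose f hfF hf hfp using fun i ↦ hF.exists_leaf_edge (hx i)
  have hfinj : Function.Injective f := by
    intro i j hij
    obtain ⟨p, hp, hpf⟩ := hfp i
    exact hxinj (hf j _ _ p hp (hij ▸ hpf)).2
  refine hF.rc_le_of_isFreeArc le_rfl hinj hadj f _ subset_rfl hfF
    fun i l h₀ h₁ y u p q hp hq ↦ ?_
  obtain rfl : l = 1 := by omega
  by_cases h : f i ∉ p.edges ∧ f i ∉ q.edges
  · exact .inl (by simpa [arc, IsFreeArc] using h)
  · have key : ∀ j, j ≠ i → f j ∉ p.edges ∧ f j ∉ q.edges := by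
      intro j hj
      by_contra hcon
      rw [← not_or, not_not] at h hcon
      have hne := (by decide : ∀ i : ZMod 3, i ≠ i + (1 : ℕ)) i
      rcases h with h | h <;> rcases hcon with hc | hc
      · exact hj (hxinj ((hf _ _ _ _ hp hc).2.symm.trans (hf _ _ _ _ hp h).2))
      · exact hne ((hf _ _ _ _ hp h).1.trans (hf _ _ _ _ hq hc).1.symm)
      · exact hne ((hf _ _ _ _ hp hc).1.trans (hf _ _ _ _ hq h).1.symm)
      · exact hj (hxinj ((hf _ _ _ _ hq hc).2.symm.trans (hf _ _ _ _ hq h).2))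
    have hi := (by decide : ∀ i : ZMod 3, i ∉ arc (i + ((1 : ℕ) : ZMod 3)) (3 - 1) ∧
      (arc (i + ((1 : ℕ) : ZMod 3)) (3 - 1)).Nodup) i
    exact .inr ⟨hi.2.map hfinj, fun k hk ↦ key k (by rintro rfl; exact hi.1 hk)⟩

/-- In a graph with a 4-cycle, one new color for the cycle suffices in the presence of two leaves
suitably placed. -/
lemma IsForestOnCycle.rc_le_of_square_of_two_leaves {v : ZMod 4 → V}
    (hF : IsForestOnCycle G v) (hinj : Function.Injective v)
    (hadj : ∀ i, G.Adj (v i) (v (i + 1))) {k : ZMod 4} {x y : V} (hk : k = 0 ∨ k = 1)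
    (hx : IsLeafAt G v 0 x) (hy : IsLeafAt G v k y) (hxy : x ≠ y) :
    rc G ≤ (G.deleteEdges (cycleEdges v)).edgeSet.ncard + 1 := by
  obtain ⟨a, haF, ha, hap⟩ := hF.exists_leaf_edge hx
  obtain ⟨b, hbF, hb, -⟩ := hF.exists_leaf_edge hy
  obtain ⟨n, hn⟩ : ∃ n, n = cycleEdge v 0 := ⟨_, rfl⟩
  have hnF : n ∉ (G.deleteEdges (cycleEdges v)).edgeSet := by
    rw [edgeSet_deleteEdges]
    exact fun h ↦ h.2 ⟨0, hn⟩
  have hnp : ∀ {i w} (p : (G.deleteEdges (cycleEdges v)).Walk (v i) w), n ∉ p.edges :=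
    fun p h ↦ hnF (p.edges_subset_edgeSet h)
  have hab : a ≠ b := by
    rintro rfl
    obtain ⟨p, hp, hpa⟩ := hap
    exact hxy (hb _ _ p hp hpa).2
  have han : a ≠ n := fun h ↦ hnF (h ▸ haF)
  have hbn : b ≠ n := fun h ↦ hnF (h ▸ hbF)
  have hna := han.symm
  have hnb := hbn.symm
  have hap : ∀ {i w} (p : (G.deleteEdges (cycleEdges v)).Walk (v i) w), p.IsPath → i ≠ 0 →
    a ∉ p.edges := fun p hp hi h ↦ hi (ha _ _ p hp h).1
  have hbp : ∀ {i w} (p : (G.deleteEdges (cycleEdges v)).Walk (v i) w), p.IsPath → i ≠ k →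
    b ∉ p.edges := fun p hp hi h ↦ hi (hb _ _ p hp h).1
  refine le_trans ?_ (Set.ncard_insert_le n _)
  rcases hk with rfl | rfl
  · refine hF.rc_le_of_isFreeArc (by norm_num) hinj hadj ![n, a, b, n] _
      (Set.subset_insert _ _) (fun i ↦ ?_) fun i l h₀ h₁ z u p q hp hq ↦ ?_
    · fin_cases i
      exacts [.inl rfl, .inr haF, .inr hbF, .inl rfl]
    · obtain rfl | rfl : l = 1 ∨ l = 2 := by omega
      · refine .inl (isFreeArc_one.2 ?_)
        obtain rfl | rfl | rfl | rfl := zmod_four_cases i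
        · exact ⟨hnp p, hnp q⟩
        · exact ⟨hap p hp (by decide), hap q hq (by decide)⟩
        · exact ⟨hbp p hp (by decide), hbp q hq (by decide)⟩
        · exact ⟨hnp p, hnp q⟩
      · refine Or.imp isFreeArc_two.2 isFreeArc_two.2 ?_
        obtain rfl | rfl | rfl | rfl := zmod_four_cases i
        · by_cases h : a ∈ p.edges
          · refine .inr ⟨hbn, ⟨fun h' ↦ hxy ?_, hbp q hq (by decide)⟩, hnp p, hnp q⟩
            exact (ha _ _ p hp h).2.symm.trans (hb _ _ p hp h').2
          · exact .inl ⟨hna, ⟨hnp p, hnp q⟩, h, hap q hq (by decide)⟩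
        · exact .inl ⟨hab, ⟨hap p hp (by decide), hap q hq (by decide)⟩,
            hbp p hp (by decide), hbp q hq (by decide)⟩
        · by_cases h : a ∈ q.edges
          · refine .inl ⟨hbn, ⟨hbp p hp (by decide), fun h' ↦ hxy ?_⟩, hnp p, hnp q⟩
            exact (ha _ _ q hq h).2.symm.trans (hb _ _ q hq h').2
          · exact .inr ⟨hna, ⟨hnp p, hnp q⟩, hap p hp (by decide), h⟩
        · exact .inr ⟨hab, ⟨hap p hp (by decide), hap q hq (by decide)⟩,
            hbp p hp (by decide), hbp q hq (by decide)⟩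
  · refine hF.rc_le_of_isFreeArc (by norm_num) hinj hadj ![n, a, n, b] _
      (Set.subset_insert _ _) (fun i ↦ ?_) fun i l h₀ h₁ z u p q hp hq ↦ ?_
    · fin_cases i
      exacts [.inl rfl, .inr haF, .inl rfl, .inr hbF]
    · obtain rfl | rfl : l = 1 ∨ l = 2 := by omega
      · refine .inl (isFreeArc_one.2 ?_)
        obtain rfl | rfl | rfl | rfl := zmod_four_cases i
        · exact ⟨hnp p, hnp q⟩
        · exact ⟨hap p hp (by decide), hap q hq (by decide)⟩
        · exact ⟨hnp p, hnp q⟩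
        · exact ⟨hbp p hp (by decide), hbp q hq (by decide)⟩
      · refine Or.imp isFreeArc_two.2 isFreeArc_two.2 ?_
        obtain rfl | rfl | rfl | rfl := zmod_four_cases i
        · exact .inr ⟨hnb, ⟨hnp p, hnp q⟩, hbp p hp (by decide), hbp q hq (by decide)⟩
        · exact .inl ⟨han, ⟨hap p hp (by decide), hap q hq (by decide)⟩, hnp p, hnp q⟩
        · exact .inl ⟨hnb, ⟨hnp p, hnp q⟩, hbp p hp (by decide), hbp q hq (by decide)⟩
        · exact .inr ⟨han, ⟨hap p hp (by decide), hap q hq (by decide)⟩, hnp p, hnp q⟩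

end UpperBounds
section LowerBounds

lemma not_isLeafAt_of_numLeaves_eq_zero [Fintype V] {s : ℕ} {v : ZMod s → V} {i : ZMod s}
    (h : numLeaves G v i = 0) (x : V) : ¬ IsLeafAt G v i x := by
  rw [numLeaves_eq_ncard, Set.ncard_eq_zero] at h
  exact fun hx ↦ Set.notMem_empty x (h ▸ hx)

namespace IsForestOnCycle

lemma injOn_forest {s : ℕ} {v : ZMod s → V} (hF : IsForestOnCycle G v) {c : Sym2 V → α}
    (hc : IsRainbowConnected G c) : Set.InjOn c (G.deleteEdges (cycleEdges v)).edgeSet := by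
  refine (injOn_bridges hc).mono ?_
  exact fun _ hf ↦ ⟨edgeSet_mono (deleteEdges_le _) hf, hF.isBridge hf⟩

section Triangle

variable {v : ZMod 3 → V} {i j k : ZMod 3}

lemma mk_mem_cycleEdges (hij : i ≠ j) : s(v i, v j) ∈ cycleEdges v := by
  rcases (by decide : ∀ i j : ZMod 3, i ≠ j → j = i + 1 ∨ i = j + 1) i j hij with rfl | rfl
  · exact ⟨_, rfl⟩
  · exact ⟨_, Sym2.eq_swap⟩

/-- A walk between two trees at a triangle uses either the edge joining them or the other
two edges of the triangle. -/
lemma mem_edges_of_triangle (hF : IsForestOnCycle G v) (hij : i ≠ j) (hik : i ≠ k) (hjk : j ≠ k)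
    {x u : V} (hx : (G.deleteEdges (cycleEdges v)).Reachable (v i) x)
    (hu : (G.deleteEdges (cycleEdges v)).Reachable (v j) u) (w : G.Walk x u) :
    s(v i, v j) ∈ w.edges ∨ s(v i, v k) ∈ w.edges ∧ s(v k, v j) ∈ w.edges := by
  have hdec : ∀ i j k l : ZMod 3, i ≠ j → i ≠ k → j ≠ k → l = i + 1 ∨ i = l + 1 → l = j ∨ l = k := by
    decide
  obtain ⟨l, hl, hlw⟩ := hF.exists_cycle_edge hij hx hu w
  rcases hdec i j k l hij hik hjk hl with rfl | rfl
  · exact .inl hlw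
  obtain ⟨m, hm, hmw⟩ := hF.exists_cycle_edge hij.symm hu hx w.reverse
  rw [Walk.edges_reverse, List.mem_reverse, Sym2.eq_swap] at hmw
  rcases hdec j i l m hij.symm hjk hik hm with rfl | rfl
  · exact .inl hmw
  · exact .inr ⟨hlw, hmw⟩

/-- Suppose that every color of an edge of the triangle is the color of a forest edge. If there is
no leaf at `v k` and there are at most two leaves at `v i`, then the color of `v i v j` does not
occur in the tree at `v i`. -/
lemma color_ne_of_triangle [Fintype V] (hF : IsForestOnCycle G v) {c : Sym2 V → α}
    (hc : IsRainbowConnected G c)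
    (hcol : ∀ i j, i ≠ j → ∃ f ∈ (G.deleteEdges (cycleEdges v)).edgeSet, c f = c s(v i, v j))
    (hij : i ≠ j) (hik : i ≠ k) (hjk : j ≠ k) (hk : ∀ x, ¬ IsLeafAt G v k x)
    (hi : {x | IsLeafAt G v i x}.ncard ≤ 2) {x : V} {f : Sym2 V} (hx : IsLeafAt G v i x)
    {p : (G.deleteEdges (cycleEdges v)).Walk (v i) x} (hp : p.IsPath) (hf : f ∈ p.edges) :
    c f ≠ c s(v i, v j) := by
  intro hcf
  have clash : ∀ {y z} (w : G.Walk y z), (w.edges.map c).Nodup → ∀ f' a b,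
      f' ∈ (G.deleteEdges (cycleEdges v)).edgeSet → a ≠ b → c f' = c s(v a, v b) →
      f' ∈ w.edges → s(v a, v b) ∉ w.edges := by
    intro y z w hw f' a b hf' hab hcab h₁ h₂
    rw [edgeSet_deleteEdges] at hf'
    exact hf'.2 (List.inj_on_of_nodup_map hw h₁ h₂ hcab ▸ mk_mem_cycleEdges hab)
  have hfF := p.edges_subset_edgeSet hf
  have detour : ∀ u, (G.deleteEdges (cycleEdges v)).Reachable (v j) u →
      ∃ w : G.Walk x u, (w.edges.map c).Nodup ∧ s(v i, v k) ∈ w.edges ∧ s(v k, v j) ∈ w.edges := by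
    intro u hu
    obtain ⟨w, -, hw⟩ := hc x u
    have hfw := hF.mem_edges_of_path hp hf (.inr ⟨j, hij.symm, hu⟩) w
    exact ⟨w, hw, (hF.mem_edges_of_triangle hij hik hjk p.reachable hu w).resolve_left
      (clash w hw f i j hfF hij hcf hfw)⟩
  have key : ∀ a b, a ≠ b → s(v a, v b) = s(v i, v k) ∨ s(v a, v b) = s(v k, v j) →
      ∃ f' ∈ (G.deleteEdges (cycleEdges v)).edgeSet, c f' = c s(v a, v b) ∧
      ∃ y, IsLeafAt G v i y ∧ y ≠ x ∧
        ∃ q : (G.deleteEdges (cycleEdges v)).Walk (v i) y, q.IsPath ∧ f' ∈ q.edges := by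
    intro a b hab hedge
    obtain ⟨f', hf'F, hf'⟩ := hcol a b hab
    refine ⟨f', hf'F, hf', ?_⟩
    obtain ⟨l, y, hy, q, hq, hfq⟩ := hF.exists_leaf hf'F
    have hmem : ∀ u (w : G.Walk x u), s(v i, v k) ∈ w.edges → s(v k, v j) ∈ w.edges →
        s(v a, v b) ∈ w.edges := by
      intro u w h₁ h₂
      rcases hedge with h | h <;> rw [h] <;> assumption
    obtain rfl : l = i := by
      by_contra hli
      obtain rfl : l = j := by
        have hlk : l ≠ k := by
          rintro rfl
          exact hk y hy
        exact (((by decide : ∀ i j k l : ZMod 3, i ≠ j → i ≠ k → j ≠ k → l = i ∨ l = j ∨ l = k)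
          i j k l hij hik hjk).resolve_left hli).resolve_right hlk
      obtain ⟨w, hw, h₁, h₂⟩ := detour y q.reachable
      have hf'w := hF.mem_edges_of_path hq hfq (.inr ⟨i, hij, p.reachable⟩) w.reverse
      rw [Walk.edges_reverse, List.mem_reverse] at hf'w
      exact clash w hw f' a b hf'F hab hf' hf'w (hmem _ w h₁ h₂)
    refine ⟨y, hy, ?_, q, hq, hfq⟩
    rintro rfl
    obtain ⟨w, hw, h₁, h₂⟩ := detour (v j) (Reachable.refl _)
    exact clash w hw f' a b hf'F hab hf'
      (hF.mem_edges_of_path hq hfq (.inr ⟨j, hij.symm, Reachable.refl _⟩) w) (hmem _ w h₁ h₂)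
  obtain ⟨f₁, hf₁, hc₁, y, hy, hyx, q₁, hq₁, hfq₁⟩ := key i k hik (.inl rfl)
  obtain ⟨f₂, hf₂, hc₂, z, hz, hzx, q₂, hq₂, hfq₂⟩ := key k j hjk.symm (.inr rfl)
  obtain rfl : y = z := by
    by_contra hyz
    exact hi.not_gt ((Set.two_lt_ncard (Set.toFinite _)).2
      ⟨x, hx, y, hy, z, hz, hyx.symm, hzx.symm, hyz⟩)
  obtain ⟨w, -, hw⟩ := hc y (v k)
  have hu : v k = v i ∨ ∃ j, j ≠ i ∧ (G.deleteEdges (cycleEdges v)).Reachable (v j) (v k) :=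
    .inr ⟨k, hik.symm, Reachable.refl _⟩
  rcases hF.mem_edges_of_triangle hik hij hjk.symm q₁.reachable (Reachable.refl _) w with h | h
  · exact clash w hw f₁ i k hf₁ hik hc₁ (hF.mem_edges_of_path hq₁ hfq₁ hu w) h
  · refine clash w hw f₂ k j hf₂ hjk.symm hc₂ (hF.mem_edges_of_path hq₂ hfq₂ hu w) ?_
    rw [Sym2.eq_swap]
    exact h.2

lemma le_rc_of_triangle [Fintype V] (hF : IsForestOnCycle G v) (hG : G.Connected)
    (hinj : Function.Injective v) (hadj : ∀ i, G.Adj (v i) (v (i + 1)))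
    (h₀ : numLeaves G v i = 0) (h₁ : numLeaves G v (i + 1) ≤ 2)
    (h₂ : numLeaves G v (i + 2) ≤ 2) : G.edgeSet.ncard - 2 ≤ rc G := by
  by_contra! hlt
  obtain ⟨c, hc⟩ := exists_rainbow_coloring hG
  have himage : c '' (G.deleteEdges (cycleEdges v)).edgeSet = Set.univ := by
    refine Set.eq_of_subset_of_ncard_le (Set.subset_univ _) ?_
    rw [(hF.injOn_forest hc).ncard_image, ncard_forest le_rfl hinj hadj, Set.ncard_univ,
      Nat.card_eq_fintype_card, Fintype.card_fin]
    omega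
  have hcol : ∀ e, ∃ f ∈ (G.deleteEdges (cycleEdges v)).edgeSet, c f = c e := fun e ↦
    himage.ge <| Set.mem_univ (c e)
  have hk := not_isLeafAt_of_numLeaves_eq_zero h₀
  obtain ⟨f, hf, hcf⟩ := hcol s(v (i + 1), v (i + 2))
  obtain ⟨l, x, hx, p, hp, hfp⟩ := hF.exists_leaf hf
  have hdec := (by decide : ∀ i : ZMod 3, i + 1 ≠ i + 2 ∧ i + 1 ≠ i ∧ i + 2 ≠ i) i
  rcases (by decide : ∀ i l : ZMod 3, l = i ∨ l = i + 1 ∨ l = i + 2) i l with rfl | rfl | rfl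
  · exact hk x hx
  · exact hF.color_ne_of_triangle hc (fun _ _ _ ↦ hcol _) hdec.1 hdec.2.1 hdec.2.2 hk h₁ hx hp hfp
      hcf
  · refine hF.color_ne_of_triangle hc (fun _ _ _ ↦ hcol _) hdec.1.symm hdec.2.2 hdec.2.1 hk h₂ hx
      hp hfp ?_
    rw [hcf, Sym2.eq_swap]

end Triangle

/-- A tree with at most one leaf is a path from the root to some vertex. -/
lemma exists_unique_leaf [Fintype V] {s : ℕ} {v : ZMod s → V} {i : ZMod s}
    (h : numLeaves G v i ≤ 1) :
    ∃ x, (G.deleteEdges (cycleEdges v)).Reachable (v i) x ∧ ∀ y, IsLeafAt G v i y → y = x := by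
  rw [numLeaves_eq_ncard, Set.ncard_le_one_iff_eq] at h
  rcases h with h | ⟨x, hx⟩
  · exact ⟨v i, Reachable.refl _, fun y hy ↦ (Set.notMem_empty y (h ▸ hy)).elim⟩
  · refine ⟨x, (hx.ge rfl : IsLeafAt G v i x).2.1, fun y hy ↦ hx.le hy⟩

lemma le_rc_of_square [Fintype V] {v : ZMod 4 → V} {i : ZMod 4} (hF : IsForestOnCycle G v)
    (hG : G.Connected) (hinj : Function.Injective v) (hadj : ∀ i, G.Adj (v i) (v (i + 1)))
    (h₀ : numLeaves G v i = 0) (h₂ : numLeaves G v (i + 2) = 0)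
    (h₁ : numLeaves G v (i + 1) ≤ 1) (h₃ : numLeaves G v (i + 3) ≤ 1) :
    G.edgeSet.ncard - 2 ≤ rc G := by
  classical
  obtain ⟨c, hc⟩ := exists_rainbow_coloring hG
  obtain ⟨x, hx, hxl⟩ := exists_unique_leaf h₁
  obtain ⟨y, hy, hyl⟩ := exists_unique_leaf h₃
  have hne := (by decide : ∀ i : ZMod 4, i + 1 ≠ i + 3) i
  obtain ⟨w, -, hw⟩ := hc x y
  obtain ⟨l, hl, hlw⟩ := hF.exists_cycle_edge hne hx hy w
  obtain ⟨m, hm, hmw⟩ := hF.exists_cycle_edge hne.symm hy hx w.reverse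
  rw [Walk.edges_reverse, List.mem_reverse] at hmw
  have hmem : ∀ f ∈ (G.deleteEdges (cycleEdges v)).edgeSet, f ∈ w.edges := by
    intro f hf
    obtain ⟨k, z, hz, p, hp, hfp⟩ := hF.exists_leaf hf
    rcases (by decide : ∀ i k : ZMod 4, k = i ∨ k = i + 1 ∨ k = i + 2 ∨ k = i + 3) i k with
      rfl | rfl | rfl | rfl
    · exact (not_isLeafAt_of_numLeaves_eq_zero h₀ z hz).elim
    · obtain rfl := hxl z hz
      exact hF.mem_edges_of_path hp hfp (.inr ⟨_, hne.symm, hy⟩) w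
    · exact (not_isLeafAt_of_numLeaves_eq_zero h₂ z hz).elim
    · obtain rfl := hyl z hz
      have := hF.mem_edges_of_path hp hfp (.inr ⟨_, hne, hx⟩) w.reverse
      rwa [Walk.edges_reverse, List.mem_reverse] at this
  have hF' : ∀ a b : ZMod 4, (b = a + 1 ∨ a = b + 1) →
      s(v a, v b) ∉ (G.deleteEdges (cycleEdges v)).edgeSet := by
    intro a b hab h
    rw [edgeSet_deleteEdges] at h
    rcases hab with rfl | rfl
    · exact h.2 ⟨a, rfl⟩
    · exact h.2 ⟨b, Sym2.eq_swap⟩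
  have hee : s(v (i + 1), v l) ≠ s(v (i + 3), v m) := by
    intro h
    rcases Sym2.eq_iff.1 h with ⟨h, -⟩ | ⟨-, h⟩
    · exact hne (hinj h)
    · rw [hinj h] at hl
      exact (by decide : ∀ i : ZMod 4, ¬ (i + 3 = i + 1 + 1 ∨ i + 1 = i + 3 + 1)) i hl
  have hcard : (insert s(v (i + 1), v l) (insert s(v (i + 3), v m)
      (G.deleteEdges (cycleEdges v)).edgeSet)).ncard ≤ rc G := by
    refine (Set.ncard_le_ncard (t := (w.edges.toFinset : Set (Sym2 V))) ?_
      (Finset.finite_toSet _)).trans ?_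
    · rintro e (rfl | rfl | he) <;> rw [List.coe_toFinset]
      exacts [hlw, hmw, hmem e he]
    · rw [Set.ncard_coe_finset]
      refine (List.toFinset_card_le _).trans ?_
      simpa using hw.length_le_card
  rw [Set.ncard_insert_of_notMem (fun h ↦ h.elim hee (hF' _ _ hl)),
    Set.ncard_insert_of_notMem (hF' _ _ hm), ncard_forest (by norm_num) hinj hadj] at hcard
  omega

end IsForestOnCycle

end LowerBounds
section Characterization

lemma mk_mem_cycleEdges_iff {s : ℕ} {v : ZMod s → V} (hinj : Function.Injective v)
    {i j : ZMod s} : s(v i, v j) ∈ cycleEdges v ↔ j = i + 1 ∨ i = j + 1 := by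
  constructor
  · rintro ⟨k, hk⟩
    rcases Sym2.eq_iff.1 hk with ⟨h₁, h₂⟩ | ⟨h₁, h₂⟩
    · obtain rfl := hinj h₁
      exact .inl (hinj h₂)
    · obtain rfl := hinj h₂
      exact .inr (hinj h₁)
  · rintro (rfl | rfl)
    · exact ⟨_, rfl⟩
    · exact ⟨_, Sym2.eq_swap⟩

lemma cycleGraph_five_adj {i j : ZMod 5} :
    (cycleGraph 5).Adj i j ↔ j = i + 1 ∨ i = j + 1 := by
  have := cycleGraph_adj (n := 3) (u := i) (v := j)
  exact this.trans ((by decide : ∀ i j : ZMod 5,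
    (i - j = 1 ∨ j - i = 1 ↔ j = i + 1 ∨ i = j + 1)) i j)

lemma nonempty_iso_cycleGraph_five_iff :
    Nonempty (G ≃g cycleGraph 5) ↔
      ∃ v : ZMod 5 → V, Function.Bijective v ∧ G.edgeSet = cycleEdges v := by
  constructor
  · rintro ⟨φ⟩
    refine ⟨φ.symm, φ.symm.bijective, ?_⟩
    ext e
    induction e with | h x y
    obtain ⟨i, rfl⟩ := φ.symm.surjective x
    obtain ⟨j, rfl⟩ := φ.symm.surjective y
    refine Iff.trans ?_ (mk_mem_cycleEdges_iff (s := 5) φ.symm.injective).symm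
    rw [mem_edgeSet, φ.symm.map_adj_iff]
    exact cycleGraph_five_adj
  · rintro ⟨v, hv, hE⟩
    refine ⟨RelIso.symm ⟨Equiv.ofBijective v hv, ?_⟩⟩
    intro i j
    refine Iff.trans ?_ ((mk_mem_cycleEdges_iff hv.injective).trans cycleGraph_five_adj.symm)
    rw [← hE, mem_edgeSet]
    rfl

variable [Fintype V]

lemma rc_le_of_numLeaves_triangle {v : ZMod 3 → V} (hG : G.Connected)
    (hm : G.edgeSet.ncard = Fintype.card V) (hinj : Function.Injective v)
    (hadj : ∀ i, G.Adj (v i) (v (i + 1)))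
    (h : ¬ ∃ i, numLeaves G v i = 0 ∧ numLeaves G v (i + 1) ≤ 2 ∧ numLeaves G v (i + 2) ≤ 2) :
    rc G ≤ G.edgeSet.ncard - 3 := by
  by_cases h₀ : ∀ i, numLeaves G v i ≠ 0
  · rw [← ncard_forest le_rfl hinj hadj]
    exact (isForestOnCycle hG hm le_rfl hinj hadj).rc_le_of_triangle_of_leaf hinj hadj
      fun i ↦ Set.nonempty_of_ncard_ne_zero (h₀ i)
  · push Not at h₀
    obtain ⟨i, hi⟩ := h₀
    obtain ⟨k, hk⟩ : ∃ k, 2 < numLeaves G v k := by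
      by_contra! hle
      exact h ⟨i, hi, hle _, hle _⟩
    rw [← zero_add k, ← numLeaves_shift, numLeaves_eq_ncard,
      Set.two_lt_ncard (Set.toFinite _)] at hk
    obtain ⟨a, ha, b, hb, c, hc, hab, hac, hbc⟩ := hk
    have hinj' : Function.Injective fun j ↦ v (j + k) := hinj.comp (add_left_injective k)
    have hadj' : ∀ i, G.Adj (v (i + k)) (v (i + 1 + k)) := fun i ↦ by
      rw [add_right_comm]
      exact hadj _
    rw [← ncard_forest le_rfl hinj' hadj']
    obtain ⟨x, hxinj, hx⟩ : ∃ x : Fin 3 → V, Function.Injective x ∧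
        ∀ i, IsLeafAt G (fun j ↦ v (j + k)) 0 (x i) := by
      refine ⟨![a, b, c], ?_, ?_⟩
      · intro i j
        fin_cases i <;> fin_cases j <;> simp [hab, hac, hbc, hab.symm, hac.symm, hbc.symm]
      · intro i
        fin_cases i
        exacts [ha, hb, hc]
    exact (isForestOnCycle hG hm le_rfl hinj' hadj').rc_le_of_triangle_of_three_leaves hinj' hadj'
      hxinj hx

lemma rc_le_of_numLeaves_square {v : ZMod 4 → V} (hG : G.Connected)
    (hm : G.edgeSet.ncard = Fintype.card V) (hinj : Function.Injective v)
    (hadj : ∀ i, G.Adj (v i) (v (i + 1)))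
    (h : ¬ ∃ i, numLeaves G v i = 0 ∧ numLeaves G v (i + 2) = 0 ∧ numLeaves G v (i + 1) ≤ 1 ∧
      numLeaves G v (i + 3) ≤ 1) :
    rc G ≤ G.edgeSet.ncard - 4 + 1 := by
  have hshift : ∀ k i : ZMod 4, i = 0 ∨ i = 1 → ∀ x y, IsLeafAt G (fun j ↦ v (j + k)) 0 x →
      IsLeafAt G (fun j ↦ v (j + k)) i y → x ≠ y → rc G ≤ G.edgeSet.ncard - 4 + 1 := by
    intro k i hi x y hx hy hxy
    have hinj' : Function.Injective fun j ↦ v (j + k) := hinj.comp (add_left_injective k)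
    have hadj' : ∀ i, G.Adj (v (i + k)) (v (i + 1 + k)) := fun i ↦ by
      rw [add_right_comm]
      exact hadj _
    rw [← ncard_forest (by norm_num) hinj' hadj']
    exact (isForestOnCycle hG hm (by norm_num) hinj' hadj').rc_le_of_square_of_two_leaves hinj'
      hadj' hi hx hy hxy
  by_cases h₁ : ∀ k, numLeaves G v k ≤ 1
  · obtain ⟨k, hk, hk'⟩ : ∃ k, numLeaves G v (0 + k) ≠ 0 ∧ numLeaves G v (1 + k) ≠ 0 := by
      by_contra! hcon
      have hcon₀ : numLeaves G v 0 ≠ 0 → numLeaves G v 1 = 0 := hcon 0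
      have hcon₁ : numLeaves G v 1 ≠ 0 → numLeaves G v 2 = 0 := hcon 1
      have hcon₂ : numLeaves G v 2 ≠ 0 → numLeaves G v 3 = 0 := hcon 2
      have hcon₃ : numLeaves G v 3 ≠ 0 → numLeaves G v 0 = 0 := hcon 3
      by_cases h₀ : numLeaves G v 0 = 0 ∧ numLeaves G v 2 = 0
      · exact h ⟨0, h₀.1, h₀.2, h₁ _, h₁ _⟩
      · exact h ⟨1, by omega, show numLeaves G v 3 = 0 by omega, h₁ _, h₁ _⟩
    rw [← numLeaves_shift] at hk hk'
    obtain ⟨x, hx⟩ := Set.nonempty_of_ncard_ne_zero hk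
    obtain ⟨y, hy⟩ := Set.nonempty_of_ncard_ne_zero hk'
    refine hshift k 1 (.inr rfl) x y hx hy ?_
    rintro rfl
    have := (isForestOnCycle hG hm (by norm_num) hinj hadj).eq_of_reachable
      (cycleEdges_shift k ▸ hx.2.1) (cycleEdges_shift k ▸ hy.2.1)
    exact (by decide : ∀ k : ZMod 4, 0 + k ≠ 1 + k) k this
  · push Not at h₁
    obtain ⟨k, hk⟩ := h₁
    rw [← zero_add k, ← numLeaves_shift, numLeaves_eq_ncard, Set.one_lt_ncard] at hk
    obtain ⟨x, hx, y, hy, hxy⟩ := hk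
    exact hshift k 0 (.inl rfl) x y hx hy hxy

lemma rc_eq_iff_of_triangle {v : ZMod 3 → V} (hG : G.Connected)
    (hm : G.edgeSet.ncard = Fintype.card V) (hinj : Function.Injective v)
    (hadj : ∀ i, G.Adj (v i) (v (i + 1))) :
    rc G = G.edgeSet.ncard - 2 ↔
      ∃ i, numLeaves G v i = 0 ∧ numLeaves G v (i + 1) ≤ 2 ∧ numLeaves G v (i + 2) ≤ 2 := by
  have hle := le_card_of_cycle hinj
  constructor
  · intro h
    by_contra hcon
    have := rc_le_of_numLeaves_triangle hG hm hinj hadj hcon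
    omega
  · rintro ⟨i, h₀, h₁, h₂⟩
    have := rc_le_of_triangle hG hinj hadj
    have := (isForestOnCycle hG hm le_rfl hinj hadj).le_rc_of_triangle hG hinj hadj h₀ h₁ h₂
    omega

lemma rc_eq_iff_of_square {v : ZMod 4 → V} (hG : G.Connected)
    (hm : G.edgeSet.ncard = Fintype.card V) (hinj : Function.Injective v)
    (hadj : ∀ i, G.Adj (v i) (v (i + 1))) :
    rc G = G.edgeSet.ncard - 2 ↔
      ∃ i, numLeaves G v i = 0 ∧ numLeaves G v (i + 2) = 0 ∧ numLeaves G v (i + 1) ≤ 1 ∧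
        numLeaves G v (i + 3) ≤ 1 := by
  have hle := le_card_of_cycle hinj
  constructor
  · intro h
    by_contra hcon
    have := rc_le_of_numLeaves_square hG hm hinj hadj hcon
    omega
  · rintro ⟨i, h₀, h₂, h₁, h₃⟩
    have := rc_le_of_cycle hG (by norm_num) hinj hadj
    have := (isForestOnCycle hG hm (by norm_num) hinj hadj).le_rc_of_square hG hinj hadj
      h₀ h₂ h₁ h₃
    omega

lemma three_le_rc_of_pentagon {v : ZMod 5 → V} (hG : G.Connected) (hv : Function.Bijective v)
    (hE : G.edgeSet = cycleEdges v) : 3 ≤ rc G := by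
  by_contra! hlt
  obtain ⟨c, hc⟩ := exists_rainbow_coloring hG
  have hadj : ∀ i j, G.Adj (v i) (v j) ↔ j = i + 1 ∨ i = j + 1 := fun i j ↦ by
    rw [← mk_mem_cycleEdges_iff hv.injective, ← hE, mem_edgeSet]
  have hne : ∀ i, (c (cycleEdge v i)).val ≠ (c (cycleEdge v (i + 1))).val := by
    intro i heq
    have hdec := (by decide : ∀ i : ZMod 5, i ≠ i + 2 ∧ ¬ (i + 2 = i + 1 ∨ i = i + 2 + 1)) i
    obtain ⟨p, -, hp⟩ := hc (v i) (v (i + 2))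
    have hlen : p.length ≤ rc G := by simpa using hp.length_le_card
    generalize hz : v (i + 2) = z at p
    match p, hp, hlen with
    | .nil, _, _ => exact hdec.1 (hv.injective hz.symm)
    | .cons h .nil, _, _ =>
      rw [← hz] at h
      exact hdec.2 ((hadj _ _).1 h)
    | .cons (v := y) h (.cons h' .nil), hp, _ =>
      obtain ⟨j, rfl⟩ := hv.surjective y
      subst hz
      obtain rfl := (by decide : ∀ i j : ZMod 5, (j = i + 1 ∨ i = j + 1) →
        (i + 2 = j + 1 ∨ j = i + 2 + 1) → j = i + 1) i j ((hadj _ _).1 h) ((hadj _ _).1 h')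
      rw [cycleEdge, cycleEdge, (by decide : ∀ i : ZMod 5, i + 1 + 1 = i + 2) i] at heq
      simp [Fin.ext_iff, heq] at hp
    | .cons _ (.cons _ (.cons _ _)), _, hlen =>
      simp only [Walk.length_cons] at hlen
      omega
  have hlt := fun i ↦ (c (cycleEdge v i)).isLt
  obtain ⟨x, hx⟩ : ∃ x : ZMod 5 → ℕ, ∀ i, x i = (c (cycleEdge v i)).val := ⟨_, fun _ ↦ rfl⟩
  simp only [← hx] at hne hlt
  have h₀ : x 0 ≠ x 1 := hne 0
  have h₁ : x 1 ≠ x 2 := hne 1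
  have h₂ : x 2 ≠ x 3 := hne 2
  have h₃ : x 3 ≠ x 4 := hne 3
  have h₄ : x 4 ≠ x 0 := hne 4
  have := hlt 0
  have := hlt 1
  have := hlt 2
  have := hlt 3
  have := hlt 4
  omega

end Characterization

/-- A connected graph which is not a tree contains a cycle. -/
lemma exists_cycle [Finite V] (h : ¬ G.IsAcyclic) :
    ∃ s, 3 ≤ s ∧ ∃ v : ZMod s → V, Function.Injective v ∧ ∀ i, G.Adj (v i) (v (i + 1)) := by
  rw [isAcyclic_iff_free_cycleGraph] at h
  push Not at h
  obtain ⟨s, hs, h⟩ := h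
  obtain ⟨φ⟩ := h
  obtain ⟨k, rfl⟩ : ∃ k, s = k + 2 := ⟨s - 2, by omega⟩
  refine ⟨k + 2, hs, φ, φ.injective, fun i ↦ φ.toHom.map_adj ?_⟩
  exact cycleGraph_adj.2 (.inr (add_sub_cancel_left (G := Fin (k + 2)) i 1))

lemma ncard_le_rc_of_isAcyclic [Finite V] (hG : G.Connected) (h : G.IsAcyclic) :
    G.edgeSet.ncard ≤ rc G := by
  convert ncard_bridges_le hG using 2
  ext e
  exact ⟨fun he ↦ ⟨he, isAcyclic_iff_forall_isBridge.1 h he⟩, fun he ↦ he.1⟩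

lemma one_le_ncard_edgeSet [Finite V] [Nontrivial V] (hG : G.Connected) :
    1 ≤ G.edgeSet.ncard := by
  have h₁ := hG.card_vert_le_card_edgeSet_add_one
  have h₂ := Finite.one_lt_card (α := V)
  rw [Nat.card_coe_set_eq] at h₁
  omega

lemma card_le_ncard_edgeSet [Fintype V] (hG : G.Connected) (h : ¬ G.IsAcyclic) :
    Fintype.card V ≤ G.edgeSet.ncard := by
  have h₁ := hG.card_vert_le_card_edgeSet_add_one
  have h₂ := mt (fun h ↦ (isTree_iff_connected_and_card.2 ⟨hG, h⟩).isAcyclic) h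
  rw [Nat.card_coe_set_eq, Nat.card_eq_fintype_card] at h₁ h₂
  omega

lemma rc_add_two_le_card [Fintype V] (hG : G.Connected) {s : ℕ} (hs : 3 ≤ s) {v : ZMod s → V}
    (hinj : Function.Injective v) (hadj : ∀ i, G.Adj (v i) (v (i + 1))) :
    rc G + 2 ≤ Fintype.card V := by
  have : NeZero s := ⟨by omega⟩
  have hle := le_card_of_cycle hinj
  rcases hs.eq_or_lt with rfl | hs'
  · have := rc_le_of_triangle hG hinj hadj
    omega
  · have := rc_le_of_cycle hG hs hinj hadj
    omega

lemma rc_eq_of_iso_cycleGraph_five [Fintype V] (hG : G.Connected)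
    (h : Nonempty (G ≃g cycleGraph 5)) : rc G = G.edgeSet.ncard - 2 := by
  obtain ⟨v, hv, hE⟩ := nonempty_iso_cycleGraph_five_iff.1 h
  have h₁ := three_le_rc_of_pentagon hG hv hE
  have h₂ := rc_le_of_cycle hG (by norm_num) hv.injective fun i ↦ by
    rw [← mem_edgeSet, hE]
    exact ⟨i, rfl⟩
  rw [← Fintype.card_of_bijective hv, ZMod.card] at h₂
  rw [hE, ncard_cycleEdges (by norm_num) hv.injective]
  omega

/-- A connected graph attaining the bound is unicyclic, and its cycle has length at most 5, with
equality only for the 5-cycle. -/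
lemma exists_short_cycle_of_rc_eq [Fintype V] [Nontrivial V] (hG : G.Connected)
    (h : rc G = G.edgeSet.ncard - 2) :
    Nonempty (G ≃g cycleGraph 5) ∨ G.edgeSet.ncard = Fintype.card V ∧
      ∃ s, (s = 3 ∨ s = 4) ∧ ∃ v : ZMod s → V, Function.Injective v ∧
        ∀ i, G.Adj (v i) (v (i + 1)) := by
  have hacyc : ¬ G.IsAcyclic := fun hacyc ↦ by
    have h₁ := ncard_le_rc_of_isAcyclic hG hacyc
    have h₂ := one_le_ncard_edgeSet hG
    omega
  have hcard := card_le_ncard_edgeSet hG hacyc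
  obtain ⟨s, hs, v, hinj, hadj⟩ := exists_cycle hacyc
  have : NeZero s := ⟨by omega⟩
  have hrc := rc_add_two_le_card hG hs hinj hadj
  have hm : G.edgeSet.ncard = Fintype.card V := by omega
  have hle := le_card_of_cycle hinj
  have hcyc := rc_le_of_cycle hG hs hinj hadj
  obtain hs' | rfl : (s = 3 ∨ s = 4) ∨ s = 5 := by omega
  · exact .inr ⟨hm, s, hs', v, hinj, hadj⟩
  left
  by_cases hsurj : Function.Surjective v
  · refine nonempty_iso_cycleGraph_five_iff.2 ⟨v, ⟨hinj, hsurj⟩, ?_⟩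
    refine (Set.eq_of_subset_of_ncard_le (cycleEdges_subset hadj) ?_).symm
    rw [ncard_cycleEdges hs hinj, hm, ← Fintype.card_of_bijective ⟨hinj, hsurj⟩, ZMod.card]
  · have h₁ := Fintype.card_lt_of_injective_not_surjective v hinj hsurj
    have h₂ := rc_le_of_pentagon hG hinj hadj hsurj
    rw [ZMod.card] at h₁
    omega

end RainbowConnection

/-- For a nontrivial connected graph `G` with m edges,
rc(G) = m − 2 if and only if (i) `G ≅ C₅`, or (ii) `G` is unicyclic with unique
cycle a triangle `v₁v₂v₃v₁` and for some `i` (mod 3), `l(vᵢ) = 0`,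
`l(v_{i+1}) ≤ 2`, `l(v_{i+2}) ≤ 2`, or (iii) `G` is unicyclic with unique cycle a
4-cycle `v₁v₂v₃v₄v₁` and for some `i` (mod 4), `l(vᵢ) = l(v_{i+2}) = 0`,
`l(v_{i+1}) ≤ 1`, `l(v_{i+3}) ≤ 1`. -/
theorem stmt_18 {V : Type*} [Fintype V] (G : SimpleGraph V)
    (hconn : G.Connected) (hV : Nontrivial V) :
    rc G = G.edgeSet.ncard - 2 ↔
      (Nonempty (G ≃g SimpleGraph.cycleGraph 5))
      ∨ (G.edgeSet.ncard = Fintype.card V ∧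
          ∃ v : ZMod 3 → V, Function.Injective v ∧
            (∀ i : ZMod 3, G.Adj (v i) (v (i + 1))) ∧
            ∃ i : ZMod 3, numLeaves G v i = 0 ∧ numLeaves G v (i + 1) ≤ 2 ∧
              numLeaves G v (i + 2) ≤ 2)
      ∨ (G.edgeSet.ncard = Fintype.card V ∧
          ∃ v : ZMod 4 → V, Function.Injective v ∧
            (∀ i : ZMod 4, G.Adj (v i) (v (i + 1))) ∧
            ∃ i : ZMod 4, numLeaves G v i = 0 ∧ numLeaves G v (i + 2) = 0 ∧
              numLeaves G v (i + 1) ≤ 1 ∧ numLeaves G v (i + 3) ≤ 1) := by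
  constructor
  · intro h
    refine (RainbowConnection.exists_short_cycle_of_rc_eq hconn h).imp_right ?_
    rintro ⟨hm, s, rfl | rfl, v, hinj, hadj⟩
    · exact .inl ⟨hm, v, hinj, hadj,
        (RainbowConnection.rc_eq_iff_of_triangle hconn hm hinj hadj).1 h⟩
    · exact .inr ⟨hm, v, hinj, hadj,
        (RainbowConnection.rc_eq_iff_of_square hconn hm hinj hadj).1 h⟩
  · rintro (h | ⟨hm, v, hinj, hadj, h⟩ | ⟨hm, v, hinj, hadj, h⟩)
    · exact RainbowConnection.rc_eq_of_iso_cycleGraph_five hconn h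
    · exact (RainbowConnection.rc_eq_iff_of_triangle hconn hm hinj hadj).2 h
    · exact (RainbowConnection.rc_eq_iff_of_square hconn hm hinj hadj).2 h
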